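/- arXiv:1808.02295 — 3 statements merged into one kernel-verified Lean document; each statement's English description precedes it below -/
import Mathlib

section
/- There exists an increasing sequence (K_n) of compact subsets of ℂ whose union is all of ℂ, and a sequence (P_n) of algebraic polynomials with complex coefficients, such that for every n: (1) |P_n(z) − ζ(z)| ≤ 1/n for all z ∈ K_n \ {1}; (2) P_n(1) = n; (3) for every z ∈ K_n ∩ (ℝ ∪ S), P_n(z) = 0 if and only if ζ(z) = 0, and every such zero of P_n is simple (i.e. P_n′(z) ≠ 0 there); (4) P_n has no zeros on K_n \ (ℝ ∪ S); and (5) P_n maps ℝ into ℝ. -/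
open Complex Set

/-- The real axis together with the critical line, as a subset of `ℂ`. -/
def realAxisUnionCriticalLine : Set ℂ :=
  {z : ℂ | z.im = 0} ∪ {z : ℂ | z.re = 1 / 2}

open Polynomial Filter Topology

/-- In the uniform closure of the polynomials on a compact set `K`, the spectrum of the coordinate
function contains no point that an unbounded connected set joins to infinity outside `K`. -/
theorem notMem_spectrum_of_not_isBounded {K : Set ℂ} [CompactSpace K] {V : Set ℂ}
    (hV : IsPreconnected V) (hVu : ¬ Bornology.IsBounded V) (hVK : Disjoint V K) {a : ℂ}
    (ha : a ∈ V) (x : (polynomialFunctions K).topologicalClosure)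
    (hx : ∀ z : K, (x : C(K, ℂ)) z = z) :
    a ∉ spectrum ℂ x := by
  have : IsClosed ((polynomialFunctions K).topologicalClosure : Set C(K, ℂ)) :=
    Subalgebra.isClosed_topologicalClosure _
  have hs : spectrum ℂ (x : C(K, ℂ)) = K := by
    rw [ContinuousMap.spectrum_eq_range]
    ext z
    simp [hx]
  intro h
  have hb := Subalgebra.spectrum_isBounded_connectedComponentIn _ x h
  rw [hs] at hb
  exact hVu (hb.subset (hV.subset_connectedComponentIn ha hVK.subset_compl_right))

theorem exists_polynomial_norm_sub_lt_of_differentiable {G : ℂ → ℂ} (hG : Differentiable ℂ G)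
    {K : Set ℂ} (hK : IsCompact K) {ε : ℝ} (hε : 0 < ε) :
    ∃ p : ℂ[X], ∀ z ∈ K, ‖p.eval z - G z‖ < ε := by
  obtain ⟨r, hr⟩ := hK.isBounded.subset_ball (0 : ℂ)
  have hs := hG.hasFPowerSeriesOnBall 0 (R := 1) one_pos
  have ht := hs.tendstoUniformlyOn (r' := r.toNNReal) ENNReal.coe_lt_top
  rw [Metric.tendstoUniformlyOn_iff] at ht
  obtain ⟨n, hn⟩ := (ht ε hε).exists
  refine ⟨∑ i ∈ Finset.range n,
    C ((cauchyPowerSeries G 0 (1 : NNReal) i) fun _ => 1) * X ^ i,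
    fun z hz => ?_⟩
  have hz' : z ∈ Metric.ball (0 : ℂ) r.toNNReal := by
    have := hr hz
    simp only [mem_ball_zero_iff] at this ⊢
    exact this.trans_le (Real.le_coe_toNNReal r)
  have := hn z hz'
  rw [dist_comm, dist_eq_norm, zero_add] at this
  suffices h : Polynomial.eval z _ = (cauchyPowerSeries G 0 (1 : NNReal)).partialSum n z by
    rwa [h]
  rw [Polynomial.eval_finsetSum]
  refine Finset.sum_congr rfl fun i _ => ?_
  have h := ContinuousMultilinearMap.map_smul_univ (cauchyPowerSeries G 0 (1 : NNReal) i)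
    (fun _ => z) (fun _ => 1)
  simp only [smul_eq_mul, mul_one, Finset.prod_const, Finset.card_univ, Fintype.card_fin] at h
  rw [eval_mul, eval_C, eval_pow, eval_X, mul_comm, h]

/-- A form of **Runge's theorem**: on a compact set `K`, a quotient of an entire function by a
polynomial whose roots can be joined to infinity outside `K` is a uniform limit of polynomials. -/
theorem exists_polynomial_norm_sub_div_lt {G : ℂ → ℂ} (hG : Differentiable ℂ G) {W : ℂ[X]}
    (hW : W ≠ 0) {K : Set ℂ} (hK : IsCompact K)
    (hWK : ∀ a, W.IsRoot a → ∃ V, IsPreconnected V ∧ ¬ Bornology.IsBounded V ∧ Disjoint V K ∧ a ∈ V)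
    {ε : ℝ} (hε : 0 < ε) :
    ∃ p : ℂ[X], ∀ z ∈ K, ‖p.eval z - G z / W.eval z‖ < ε := by
  have : CompactSpace K := isCompact_iff_compactSpace.mp hK
  let A := (polynomialFunctions K).topologicalClosure
  have hmem (p : ℂ[X]) : toContinuousMapOnAlgHom K p ∈ A :=
    Subalgebra.le_topologicalClosure _ (by
      rw [← SetLike.mem_coe, polynomialFunctions_coe]
      exact ⟨p, rfl⟩)
  let φ : ℂ[X] →ₐ[ℂ] A := (toContinuousMapOnAlgHom K).codRestrict A hmem
  have hunit : IsUnit (φ W) := by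
    rw [(IsAlgClosed.splits W).eq_prod_roots, map_mul]
    refine IsUnit.mul (((isUnit_iff_ne_zero.mpr (leadingCoeff_ne_zero.mpr hW)).map C).map φ) ?_
    have hφ : φ = aeval (φ X) := by ext; simp
    by_contra h
    rw [hφ] at h
    obtain ⟨a, ha, ha0⟩ := spectrum.exists_mem_of_not_isUnit_aeval_prod h
    obtain ⟨V, hV, hVu, hVK, haV⟩ := hWK a ha0
    exact notMem_spectrum_of_not_isBounded hV hVu hVK haV (φ X) (fun z => eval_X) ha
  obtain ⟨u, hu⟩ := hunit.exists_right_inv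
  let g : C(K, ℂ) := ⟨fun z => G z, hG.continuous.comp continuous_subtype_val⟩
  have hg : g ∈ A := by
    rw [← SetLike.mem_coe, Subalgebra.topologicalClosure_coe, Metric.mem_closure_iff]
    intro η hη
    obtain ⟨p, hp⟩ := exists_polynomial_norm_sub_lt_of_differentiable hG hK hη
    refine ⟨toContinuousMapOnAlgHom K p, by rw [polynomialFunctions_coe]; exact ⟨p, rfl⟩, ?_⟩
    rw [dist_comm, dist_eq_norm, ContinuousMap.norm_lt_iff _ hη]
    exact fun z => hp z z.2
  have hgu := A.mul_mem hg u.2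
  rw [← SetLike.mem_coe, Subalgebra.topologicalClosure_coe, Metric.mem_closure_iff] at hgu
  obtain ⟨q, hq, hlt⟩ := hgu ε hε
  rw [polynomialFunctions_coe] at hq
  obtain ⟨p, rfl⟩ := hq
  rw [dist_comm, dist_eq_norm, ContinuousMap.norm_lt_iff _ hε] at hlt
  refine ⟨p, fun z hz => ?_⟩
  have huz : W.eval z * (u : C(K, ℂ)) ⟨z, hz⟩ = 1 :=
    DFunLike.congr_fun (congrArg Subtype.val hu) ⟨z, hz⟩
  have h := hlt ⟨z, hz⟩
  rw [div_eq_mul_inv, ← eq_inv_of_mul_eq_one_right huz]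
  exact h

/-- Runge approximation on `K` of a function with at most a simple pole, combined with prescribed
values at finitely many points outside `K` and simple zeros at some of them. -/
theorem exists_polynomial_interpolating {K : Set ℂ} (hK : IsCompact K) {F L : Finset ℂ}
    (hLF : L ⊆ F)
    (hFK : ∀ a ∈ F, ∃ V, IsPreconnected V ∧ ¬ Bornology.IsBounded V ∧ Disjoint V K ∧ a ∈ V)
    {f E : ℂ → ℂ} (hE : Differentiable ℂ E) {c : ℂ} (hc : c ∈ F)
    (hfE : ∀ z ∈ K, E z = (z - c) * f z) (v : ℂ → ℂ) {ε : ℝ} (hε : 0 < ε) :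
    ∃ p : ℂ[X], (∀ z ∈ K, ‖p.eval z - f z‖ < ε) ∧
      (∀ a ∈ L, p.eval a = 0 ∧ p.derivative.eval a = 1) ∧ ∀ a ∈ F, a ∉ L → p.eval a = v a := by
  classical
  let M := Lagrange.nodal L (id : ℂ → ℂ)
  let N := Lagrange.nodal F (id : ℂ → ℂ)
  let I := Lagrange.interpolate F (id : ℂ → ℂ)
    fun a => if a ∈ L then (M.derivative.eval a)⁻¹ else v a / M.eval a
  have hI (a : ℂ) (ha : a ∈ F) :
      I.eval a = if a ∈ L then (M.derivative.eval a)⁻¹ else v a / M.eval a :=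
    Lagrange.eval_interpolate_at_node (v := id) _ Function.injective_id.injOn ha
  have hNK (z : ℂ) (hz : z ∈ K) : z ∉ F := fun h =>
    let ⟨_, _, _, hd, ha⟩ := hFK z h
    hd.ne_of_mem ha hz rfl
  have hM0 (z : ℂ) : M.eval z = 0 ↔ z ∈ L := by
    simp [M, Lagrange.eval_nodal, Finset.prod_eq_zero_iff, sub_eq_zero]
  have hN0 (z : ℂ) : N.eval z = 0 ↔ z ∈ F := by
    simp [N, Lagrange.eval_nodal, Finset.prod_eq_zero_iff, sub_eq_zero]
  have hM' (a : ℂ) (ha : a ∈ L) : M.derivative.eval a ≠ 0 := by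
    have h := Lagrange.eval_nodal_derivative_eval_node_eq (v := (id : ℂ → ℂ)) ha
    rw [id] at h
    rw [h, Lagrange.eval_nodal, Finset.prod_ne_zero_iff]
    intro b hb
    exact sub_ne_zero.mpr (Finset.ne_of_mem_erase hb).symm
  obtain ⟨B, hB⟩ := hK.exists_bound_of_continuousOn (f := fun z => (M * N).eval z)
    (Polynomial.continuous _).continuousOn
  have hB' : 0 < |B| + 1 := by positivity
  obtain ⟨R, hR⟩ := exists_polynomial_norm_sub_div_lt
    (G := fun z => E z - (z - c) * (M * I).eval z) (by fun_prop)
    (W := (X - C c) * (M * N))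
    (mul_ne_zero (X_sub_C_ne_zero c) (mul_ne_zero Lagrange.nodal_ne_zero Lagrange.nodal_ne_zero)) hK
    (fun a ha => hFK a (by
      simp only [IsRoot.def, eval_mul, eval_sub, eval_X, eval_C, mul_eq_zero, sub_eq_zero, hM0,
        hN0] at ha
      rcases ha with rfl | ha | ha
      exacts [hc, hLF ha, ha]))
    (div_pos hε hB')
  refine ⟨M * (I + N * R), fun z hz => ?_, fun a ha => ⟨?_, ?_⟩, fun a ha haL => ?_⟩
  · have hzc : z - c ≠ 0 := sub_ne_zero.mpr fun h => hNK z hz (h ▸ hc)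
    have hMz : M.eval z ≠ 0 := fun h => hNK z hz (hLF ((hM0 z).1 h))
    have hNz : N.eval z ≠ 0 := fun h => hNK z hz ((hN0 z).1 h)
    have h := hR z hz
    have heq : (M * (I + N * R)).eval z - f z = (M * N).eval z *
        (R.eval z - (E z - (z - c) * (M * I).eval z) /
          ((X - C c) * (M * N)).eval z) := by
      rw [hfE z hz]
      simp only [eval_mul, eval_add, eval_sub, eval_X, eval_C]
      field_simp
      ring
    rw [heq, norm_mul]
    calc _ ≤ (|B| + 1) * _ := by gcongr; linarith [hB z hz, le_abs_self B]
      _ < (|B| + 1) * (ε / (|B| + 1)) := by gcongr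
      _ = ε := by field_simp
  · simp [(hM0 a).2 ha]
  · simp [derivative_mul, (hM0 a).2 ha, (hN0 a).2 (hLF ha), hI a (hLF ha), ha, hM' a ha]
  · have := mt (hM0 a).1 haL
    simp only [eval_mul, eval_add, (hN0 a).2 ha, hI a ha, if_neg haL]
    field_simp
    ring

open ComplexConjugate in
theorem Polynomial.eval_map_starRingEnd (p : ℂ[X]) (z : ℂ) :
    (p.map (starRingEnd ℂ)).eval z = conj (p.eval (conj z)) := by
  rw [eval_map, ← eval₂_hom, Complex.conj_conj]

theorem exists_differentiable_eq_sub_one_mul_riemannZeta :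
    ∃ E : ℂ → ℂ, Differentiable ℂ E ∧ ∀ z ≠ 1, E z = (z - 1) * riemannZeta z := by
  let E := Function.update (fun z => (z - 1) * riemannZeta z) 1 1
  have hE (z : ℂ) (hz : z ≠ 1) : E z = (z - 1) * riemannZeta z := Function.update_of_ne hz _ _
  refine ⟨E, ?_, hE⟩
  rw [← differentiableOn_univ, ← differentiableOn_compl_singleton_and_continuousAt_iff
    (c := 1) univ_mem]
  refine ⟨fun z hz => ?_, continuousAt_update_same.mpr riemannZeta_residue_one⟩
  have hz1 : z ≠ 1 := hz.2
  refine DifferentiableAt.differentiableWithinAt ?_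
  refine DifferentiableAt.congr_of_eventuallyEq (f := fun z => (z - 1) * riemannZeta z) ?_ ?_
  · exact (by fun_prop : DifferentiableAt ℂ (fun z : ℂ => z - 1) z).mul
      (differentiableAt_riemannZeta hz1)
  · filter_upwards [isOpen_ne.mem_nhds hz1] with w hw using hE w hw

/-- The closed disc of radius `r` from which, for each `a ∈ S`, the open disc of radius `δ` about
`a` and the two thin open half-strips on both sides of the vertical ray that leads from `a` away
from the real axis (of both such rays if `a` is real) have been removed. -/
def slitDisc (S : Set ℂ) (r δ : ℝ) : Set ℂ :=
  {z | ‖z‖ ≤ r ∧ ∀ a ∈ S, δ ≤ ‖z - a‖ ∧ (|z.im| ≤ |a.im| ∨ z.re = a.re ∨ δ ≤ |z.re - a.re|)}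

theorem isCompact_slitDisc (S : Set ℂ) (r δ : ℝ) : IsCompact (slitDisc S r δ) := by
  refine (isCompact_closedBall (0 : ℂ) r).of_isClosed_subset ?_ fun z hz => by
    simpa using hz.1
  simp only [slitDisc, ofPred_and, ofPred_forall, ofPred_or]
  refine (isClosed_le (by fun_prop) (by fun_prop)).inter
    (isClosed_biInter fun a _ => IsClosed.inter ?_ (IsClosed.union ?_ (IsClosed.union ?_ ?_)))
  · exact isClosed_le (by fun_prop) (by fun_prop)
  · exact isClosed_le (by fun_prop) (by fun_prop)
  · exact isClosed_eq (by fun_prop) (by fun_prop)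
  · exact isClosed_le (by fun_prop) (by fun_prop)

theorem slitDisc_subset_slitDisc (S : Set ℂ) {r r' δ δ' : ℝ} (hr : r ≤ r') (hδ : δ' ≤ δ) :
    slitDisc S r δ ⊆ slitDisc S r' δ' := fun _ hz =>
  ⟨hz.1.trans hr, fun a ha => ⟨hδ.trans (hz.2 a ha).1,
    (hz.2 a ha).2.imp_right (Or.imp_right hδ.trans)⟩⟩

open ComplexConjugate in
theorem conj_mem_slitDisc {S : Set ℂ} (hS : ∀ a ∈ S, conj a ∈ S) {r δ : ℝ} {z : ℂ}
    (hz : z ∈ slitDisc S r δ) : conj z ∈ slitDisc S r δ := by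
  refine ⟨by simpa using hz.1, fun a ha => ?_⟩
  have h := hz.2 _ (hS a ha)
  have hn : ‖conj z - a‖ = ‖z - conj a‖ := by
    rw [← Complex.norm_conj, map_sub, Complex.conj_conj]
  simpa [hn] using h

theorem notMem_of_mem_slitDisc {S : Set ℂ} {r δ : ℝ} (hδ : 0 < δ) {z : ℂ}
    (hz : z ∈ slitDisc S r δ) : z ∉ S := fun h => by
  have := (hz.2 z h).1
  rw [sub_self, norm_zero] at this
  exact this.not_gt hδ

theorem exists_isPreconnected_disjoint_slitDisc {S : Set ℂ} {r δ : ℝ} (hδ : 0 < δ) {a : ℂ}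
    (ha : a ∈ S) : ∃ V, IsPreconnected V ∧ ¬ Bornology.IsBounded V ∧
      Disjoint V (slitDisc S r δ) ∧ a ∈ V := by
  obtain ⟨s, hs, hsa⟩ : ∃ s : ℝ, |s| = 1 ∧ s * a.im = |a.im| := by
    rcases le_total 0 a.im with h | h
    · exact ⟨1, by simp, by rw [abs_of_nonneg h, one_mul]⟩
    · exact ⟨-1, by simp, by rw [abs_of_nonpos h]; ring⟩
  have hss : s * s = 1 := by rw [← abs_mul_abs_self, hs, one_mul]
  let H : Set ℂ := reLm ⁻¹' Ioo a.re (a.re + δ) ∩ (s • imLm) ⁻¹' Ioi (s * a.im)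
  have hH : Convex ℝ H :=
    ((convex_Ioo _ _).linear_preimage _).inter ((convex_Ioi _).linear_preimage _)
  have hmem (y : ℝ) (hy : 0 < y) (x : ℝ) (hx : 0 < x) (hxδ : x < δ) :
      a + (x + (s * y : ℝ) * I) ∈ H := by
    refine ⟨⟨?_, ?_⟩, ?_⟩ <;> simp [hx, hxδ, mul_add, ← mul_assoc, hss, hy]
  refine ⟨Metric.ball a δ ∪ H, ?_, ?_, ?_, Or.inl (Metric.mem_ball_self hδ)⟩
  · refine IsPreconnected.union (a + ((δ / 4 : ℝ) + (s * (δ / 4) : ℝ) * I)) ?_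
      (hmem _ (by positivity) _ (by positivity) (by linarith))
      (convex_ball a δ).isPreconnected hH.isPreconnected
    rw [mem_ball_iff_norm, add_sub_cancel_left]
    refine (norm_add_le _ _).trans_lt ?_
    rw [norm_mul, norm_I, norm_real, norm_real, Real.norm_eq_abs, Real.norm_eq_abs, abs_mul, hs,
      abs_of_pos (by positivity : 0 < δ / 4)]
    linarith
  · intro hb
    obtain ⟨B, hB⟩ := hb.exists_norm_le
    have hm := hB _ (Or.inr (hmem (|B| + |a.im| + 1) (by positivity) (δ / 2) (by positivity)
      (by linarith)))
    have h := (abs_im_le_norm _).trans hm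
    have hs' : |s * (|B| + |a.im| + 1)| = |B| + |a.im| + 1 := by
      rw [abs_mul, hs, one_mul, abs_of_pos (by positivity)]
    have h' := abs_sub_abs_le_abs_sub (s * (|B| + |a.im| + 1)) (-a.im)
    rw [abs_neg, sub_neg_eq_add, hs', add_comm _ a.im] at h'
    simp only [add_im, ofReal_im, im_ofReal_mul, I_im, mul_one, zero_add] at h
    linarith [le_abs_self B]
  · rw [Set.disjoint_left]
    rintro z (hz | ⟨⟨h1, h2⟩, h3⟩) hzD
    · exact (hzD.2 a ha).1.not_gt (mem_ball_iff_norm.mp hz)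
    · rw [reLm_coe] at h1 h2
      replace h3 : s * a.im < s * z.im := h3
      rcases (hzD.2 a ha).2 with h | h | h
      · have : s * z.im ≤ |z.im| := by
          calc _ ≤ |s * z.im| := le_abs_self _
            _ = _ := by rw [abs_mul, hs, one_mul]
        linarith
      · linarith
      · rw [abs_of_pos (sub_pos.mpr h1)] at h
        linarith

theorem eventually_mem_slitDisc {S : Set ℂ} (hS : ∀ r, (S ∩ Metric.closedBall 0 r).Finite) {z : ℂ}
    (hz : z ∉ S) : ∀ᶠ n : ℕ in atTop, z ∈ slitDisc S (n + 1) (1 / (n + 1)) := by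
  have hpos {ε : ℝ} (hε : 0 < ε) : ∀ᶠ n : ℕ in atTop, 1 / ((n : ℝ) + 1) ≤ ε :=
    (tendsto_one_div_add_atTop_nhds_zero_nat.eventually_lt_const hε).mono fun _ h => h.le
  have hfin := (eventually_all_finite (hS (2 * ‖z‖ + 1))).mpr fun a ha =>
    show ∀ᶠ n : ℕ in atTop, 1 / ((n : ℝ) + 1) ≤ ‖z - a‖ ∧
      (z.re = a.re ∨ 1 / ((n : ℝ) + 1) ≤ |z.re - a.re|) by
    have hza : z ≠ a := fun h => hz (h ▸ ha.1)
    refine (hpos (norm_pos_iff.mpr (sub_ne_zero.mpr hza))).and ?_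
    by_cases h : z.re = a.re
    · exact Eventually.of_forall fun _ => Or.inl h
    · exact (hpos (abs_pos.mpr (sub_ne_zero.mpr h))).mono fun _ => Or.inr
  filter_upwards [hfin, hpos one_pos, eventually_ge_atTop ⌈‖z‖⌉₊] with n hn h1 hz'
  refine ⟨by linarith [Nat.ceil_le.mp hz'], fun a ha => ?_⟩
  by_cases haz : ‖a‖ ≤ 2 * ‖z‖ + 1
  · have h := hn a ⟨ha, by simpa using haz⟩
    exact ⟨h.1, Or.inr h.2⟩
  · refine ⟨h1.trans ?_, ?_⟩
    · linarith [norm_sub_norm_le a z, norm_sub_rev a z, norm_nonneg z]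
    · by_contra! hc
      have := Complex.norm_le_abs_re_add_abs_im a
      have := abs_im_le_norm z
      have := abs_re_le_norm z
      have := abs_sub_abs_le_abs_sub a.re z.re
      have := abs_sub_comm a.re z.re
      linarith

open ComplexConjugate in
theorem conj_mem_realAxisUnionCriticalLine {z : ℂ} :
    conj z ∈ realAxisUnionCriticalLine ↔ z ∈ realAxisUnionCriticalLine := by
  simp [realAxisUnionCriticalLine]

/-- The zeros of the Riemann zeta function together with its pole. -/
def riemannZetaZerosAndPole : Set ℂ := insert 1 riemannZetaZeros

open ComplexConjugate in
theorem conj_mem_riemannZetaZerosAndPole {a : ℂ} (ha : a ∈ riemannZetaZerosAndPole) :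
    conj a ∈ riemannZetaZerosAndPole := by
  rcases ha with rfl | ha
  · exact Or.inl (map_one _)
  · exact Or.inr (by rw [mem_riemannZetaZeros] at ha ⊢; rw [riemannZeta_conj, ha, map_zero])

theorem finite_riemannZetaZerosAndPole_inter_closedBall (r : ℝ) :
    (riemannZetaZerosAndPole ∩ Metric.closedBall 0 r).Finite := by
  refine (((isCompact_closedBall 0 r).inter_riemannZetaZeros_finite).insert 1).subset ?_
  rintro a ⟨rfl | ha, har⟩
  exacts [Or.inl rfl, Or.inr ⟨har, ha⟩]

open ComplexConjugate in
theorem exists_polynomial_approx_riemannZeta (n : ℕ) :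
    ∃ p : ℂ[X],
      (∀ z ∈ slitDisc riemannZetaZerosAndPole (n + 1) (1 / (n + 1)),
        ‖p.eval z - riemannZeta z‖ ≤ 1 / (n + 1) ∧ p.eval z ≠ 0) ∧
      p.eval 1 = n + 1 ∧
      (∀ a ∈ riemannZetaZeros ∩ Metric.closedBall 0 (n + 1),
        (a ∈ realAxisUnionCriticalLine → p.eval a = 0 ∧ p.derivative.eval a = 1) ∧
        (a ∉ realAxisUnionCriticalLine → p.eval a = 1 / (n + 1))) ∧
      ∀ x : ℝ, (p.eval (x : ℂ)).im = 0 := by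
  classical
  set K := slitDisc riemannZetaZerosAndPole (n + 1) (1 / (n + 1))
  have hn : (0 : ℝ) < 1 / (n + 1) := by positivity
  have hK : IsCompact K := isCompact_slitDisc _ _ _
  have hKS (z : ℂ) (hz : z ∈ K) : z ≠ 1 ∧ riemannZeta z ≠ 0 := by
    have := notMem_of_mem_slitDisc hn hz
    exact ⟨fun h => this (Or.inl h), fun h => this (Or.inr h)⟩
  obtain ⟨m, hm, hmK⟩ : ∃ m : ℝ, 0 < m ∧ ∀ z ∈ K, m ≤ ‖riemannZeta z‖ := by
    rcases K.eq_empty_or_nonempty with h | h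
    · exact ⟨1, one_pos, by simp [h]⟩
    · obtain ⟨w, hw, hwK⟩ := hK.exists_isMinOn h (f := fun z => ‖riemannZeta z‖) fun z hz =>
        (differentiableAt_riemannZeta (hKS z hz).1).continuousAt.norm.continuousWithinAt
      exact ⟨_, norm_pos_iff.mpr (hKS w hw).2, fun z hz => hwK hz⟩
  let F := (finite_riemannZetaZerosAndPole_inter_closedBall (n + 1)).toFinset
  let L := {a ∈ F | riemannZeta a = 0 ∧ a ∈ realAxisUnionCriticalLine}
  have hF (a : ℂ) : a ∈ F ↔ a ∈ riemannZetaZerosAndPole ∧ ‖a‖ ≤ n + 1 := by simp [F]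
  have h1F : (1 : ℂ) ∈ F := (hF 1).2 ⟨Or.inl rfl, by simp⟩
  have h1L : (1 : ℂ) ∉ L := by simp [L, riemannZeta_one_ne_zero]
  obtain ⟨E, hE, hEz⟩ := exists_differentiable_eq_sub_one_mul_riemannZeta
  obtain ⟨q, hqK, hqL, hqF⟩ := exists_polynomial_interpolating hK (L := L)
    (Finset.filter_subset _ F)
    (fun a ha => exists_isPreconnected_disjoint_slitDisc hn ((hF a).1 ha).1) hE h1F
    (fun z hz => hEz z (hKS z hz).1) (fun a => if a = 1 then (n + 1 : ℂ) else 1 / (n + 1))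
    (lt_min hn hm)
  let p := C (1 / 2 : ℂ) * (q + q.map (starRingEnd ℂ))
  have hp (z : ℂ) : p.eval z = (q.eval z + conj (q.eval (conj z))) / 2 := by
    simp only [p, eval_mul, eval_add, eval_C, eval_map_starRingEnd]
    ring
  have hp' (z : ℂ) :
      p.derivative.eval z = (q.derivative.eval z + conj (q.derivative.eval (conj z))) / 2 := by
    simp only [p, derivative_C_mul, derivative_add, derivative_map, eval_mul, eval_add, eval_C,
      eval_map_starRingEnd]
    ring
  have happ (z : ℂ) (hz : z ∈ K) : ‖p.eval z - riemannZeta z‖ < min (1 / (n + 1) : ℝ) m := by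
    have h1 := hqK z hz
    have h2 := hqK _ (conj_mem_slitDisc (fun _ => conj_mem_riemannZetaZerosAndPole) hz)
    rw [riemannZeta_conj, ← Complex.norm_conj, map_sub, Complex.conj_conj] at h2
    have heq : p.eval z - riemannZeta z =
        ((q.eval z - riemannZeta z) + (conj (q.eval (conj z)) - riemannZeta z)) / 2 := by
      rw [hp]; ring
    rw [heq, norm_div, Complex.norm_ofNat, div_lt_iff₀ two_pos]
    linarith [norm_add_le (q.eval z - riemannZeta z) (conj (q.eval (conj z)) - riemannZeta z)]
  refine ⟨p, fun z hz => ⟨((happ z hz).trans_le (min_le_left _ _)).le, fun h => ?_⟩, ?_, ?_, ?_⟩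
  · have := (happ z hz).trans_le ((min_le_right _ _).trans (hmK z hz))
    rw [h, zero_sub, norm_neg] at this
    exact this.false
  · simp [hp, hqF 1 h1F h1L]
  · rintro a ⟨ha, har⟩
    rw [mem_riemannZetaZeros] at ha
    rw [mem_closedBall_zero_iff] at har
    have haF : a ∈ F := (hF a).2 ⟨Or.inr ha, har⟩
    have ha' : riemannZeta (conj a) = 0 := by rw [riemannZeta_conj, ha, map_zero]
    have haF' : conj a ∈ F := (hF _).2 ⟨Or.inr ha', by simpa using har⟩
    constructor
    · intro hal
      have h1 := hqL a (Finset.mem_filter.mpr ⟨haF, ha, hal⟩)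
      have h2 := hqL (conj a) (Finset.mem_filter.mpr ⟨haF', ha',
        conj_mem_realAxisUnionCriticalLine.mpr hal⟩)
      simp [hp, hp', h1, h2]
    · intro hal
      have hne {b : ℂ} (hb : riemannZeta b = 0) : b ≠ 1 := fun h =>
        riemannZeta_one_ne_zero (h ▸ hb)
      have h1 := hqF a haF fun h => hal (Finset.mem_filter.mp h).2.2
      have h2 := hqF (conj a) haF' fun h => hal
        (conj_mem_realAxisUnionCriticalLine.mp (Finset.mem_filter.mp h).2.2)
      rw [if_neg (hne ha)] at h1
      rw [if_neg (hne ha')] at h2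
      simp [hp, h1, h2]
  · intro x
    rw [hp, conj_ofReal, add_conj, div_ofNat_im]
    simp

/-- There exists an increasing sequence `K_n` of compact subsets of `ℂ` with union `ℂ`,
and a sequence of algebraic polynomials `P_n` (indexed so that `P n` plays the role of
`P_{n+1}`), satisfying properties (1)-(5). -/
theorem zeta_approx_by_polynomials :
    ∃ (K : ℕ → Set ℂ) (P : ℕ → Polynomial ℂ),
      (∀ n, IsCompact (K n)) ∧
      Monotone K ∧
      (⋃ n, K n) = Set.univ ∧
      ∀ n : ℕ,
        (∀ z ∈ K n \ {1}, ‖(P n).eval z - riemannZeta z‖ ≤ 1 / (n + 1)) ∧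
        ((P n).eval 1 = (n + 1 : ℂ)) ∧
        (∀ z ∈ K n ∩ realAxisUnionCriticalLine,
          ((P n).eval z = 0 ↔ riemannZeta z = 0) ∧
          ((P n).eval z = 0 → ((P n).derivative).eval z ≠ 0)) ∧
        (∀ z ∈ K n \ realAxisUnionCriticalLine, (P n).eval z ≠ 0) ∧
        (∀ x : ℝ, ((P n).eval (x : ℂ)).im = 0) := by
  choose P hPK hP1 hPZ hPR using exists_polynomial_approx_riemannZeta
  have hS := finite_riemannZetaZerosAndPole_inter_closedBall
  refine ⟨fun n => slitDisc riemannZetaZerosAndPole (n + 1) (1 / (n + 1)) ∪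
    riemannZetaZerosAndPole ∩ Metric.closedBall 0 (n + 1), P,
    fun n => (isCompact_slitDisc _ _ _).union (hS _).isCompact, ?_, ?_, fun n => ?_⟩
  · intro m n hmn
    have : (m : ℝ) ≤ n := by exact_mod_cast hmn
    exact union_subset_union (slitDisc_subset_slitDisc _ (by gcongr) (by gcongr))
      (inter_subset_inter_right _ (Metric.closedBall_subset_closedBall (by gcongr)))
  · refine eq_univ_of_forall fun z => mem_iUnion.mpr ?_
    by_cases hz : z ∈ riemannZetaZerosAndPole
    · exact ⟨⌈‖z‖⌉₊, Or.inr ⟨hz, by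
        rw [mem_closedBall_zero_iff]; linarith [Nat.le_ceil ‖z‖]⟩⟩
    · obtain ⟨n, hn⟩ := (eventually_mem_slitDisc hS hz).exists
      exact ⟨n, Or.inl hn⟩
  · have hn0 : (n + 1 : ℂ) ≠ 0 := Nat.cast_add_one_ne_zero n
    have hn : (0 : ℝ) < 1 / (n + 1) := by positivity
    refine ⟨?_, hP1 n, ?_, ?_, hPR n⟩
    · rintro z ⟨hz | ⟨rfl | hz, hzn⟩, hz1⟩
      · exact (hPK n z hz).1
      · exact absurd rfl hz1
      · have h := hPZ n z ⟨hz, hzn⟩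
        rw [mem_riemannZetaZeros] at hz
        rw [hz, sub_zero]
        by_cases hzl : z ∈ realAxisUnionCriticalLine
        · rw [(h.1 hzl).1, norm_zero]
          exact hn.le
        · rw [h.2 hzl]
          simp only [norm_div, norm_one, ← Nat.cast_add_one, Complex.norm_natCast, le_refl]
    · rintro z ⟨hz | ⟨rfl | hz, hzn⟩, hzl⟩
      · have h := (hPK n z hz).2
        exact ⟨iff_of_false h fun h0 => notMem_of_mem_slitDisc hn hz (Or.inr h0),
          fun h0 => absurd h0 h⟩
      · rw [hP1 n]
        exact ⟨iff_of_false hn0 riemannZeta_one_ne_zero, fun h0 => absurd h0 hn0⟩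
      · have h := (hPZ n z ⟨hz, hzn⟩).1 hzl
        exact ⟨iff_of_true h.1 hz, fun _ => by rw [h.2]; exact one_ne_zero⟩
    · rintro z ⟨hz | ⟨rfl | hz, hzn⟩, hzl⟩
      · exact (hPK n z hz).2
      · rw [hP1 n]
        exact hn0
      · rw [(hPZ n z ⟨hz, hzn⟩).2 hzl]
        exact one_div_ne_zero hn0
end

section
/- There exist a sequence (P_n) of algebraic polynomials and a sequence (D_n) of Dirichlet polynomials such that P_n(z) → ζ(z) and D_n(z) → ζ(z) as n → ∞ for every z ∈ ℂ with z ≠ 1, while |P_n(1)| → ∞ and |D_n(1)| → ∞. -/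
open Complex Filter

/-- A Dirichlet polynomial: a function of the form `z ↦ ∑_{k=1}^m a_k k^{-z}`. -/
def IsDirichletPolynomial (f : ℂ → ℂ) : Prop :=
  ∃ (m : ℕ) (a : ℕ → ℂ), ∀ z : ℂ, f z = ∑ k ∈ Finset.Icc 1 m, a k * (k : ℂ) ^ (-z)

open Polynomial Topology

/-- An entire function vanishing on a finite set is divisible by the product of the corresponding
linear factors. -/
lemma exists_entire_factor (s : Finset ℂ) {g : ℂ → ℂ} (hg : Differentiable ℂ g)
    (hs : ∀ a ∈ s, g a = 0) :
    ∃ h : ℂ → ℂ, Differentiable ℂ h ∧ ∀ z, g z = (∏ a ∈ s, (z - a)) * h z := by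
  induction s using Finset.induction_on with
  | empty => exact ⟨g, hg, by simp⟩
  | insert a s ha ih =>
    obtain ⟨h, hh, hgh⟩ := ih fun b hb => hs b (Finset.mem_insert_of_mem hb)
    have h_zero : h a = 0 := by
      have := hs a (Finset.mem_insert_self a s)
      rw [hgh] at this
      refine (mul_eq_zero.mp this).resolve_left (Finset.prod_ne_zero_iff.mpr fun b hb => ?_)
      exact sub_ne_zero.mpr fun hab => ha (hab ▸ hb)
    refine ⟨dslope h a, ?_, fun z => ?_⟩
    · rw [← differentiableOn_univ, Complex.differentiableOn_dslope univ_mem]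
      exact hh.differentiableOn
    · have := sub_smul_dslope h a z
      rw [h_zero, sub_zero, smul_eq_mul] at this
      rw [hgh, Finset.prod_insert ha, ← this]
      ring

/-- An entire function of exponential type is bounded in terms of the number of its zeros
`log 1, …, log M`. -/
lemma norm_le_of_zeros_log {g : ℂ → ℂ} (hg : Differentiable ℂ g) {C : ℝ} {R M : ℕ}
    (hbound : ∀ z, ‖g z‖ ≤ C * Real.exp (R * ‖z‖))
    (hzero : ∀ k : ℕ, 1 ≤ k → g (Real.log k) = 0) (hM : 2 ≤ M) {z : ℂ}
    (hz : ‖z‖ ≤ Real.log M / 2) :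
    ‖g z‖ ≤ C * ((M : ℝ) ^ (4 * R) * (1 / 2) ^ M) := by
  have hM_pos : (0 : ℝ) < M := by positivity
  set L := Real.log M with hL
  have hL_pos : 0 < L := Real.log_pos (by exact_mod_cast hM)
  have hinj : Set.InjOn (fun k : ℕ => ((Real.log k : ℝ) : ℂ)) (Finset.Icc 1 M : Finset ℕ) := by
    intro i hi j hj hij
    simp only [Finset.coe_Icc, Set.mem_Icc] at hi hj
    have h_eq := Real.log_injOn_pos (x₁ := i) (x₂ := j) (by simp; omega) (by simp; omega)
      (Complex.ofReal_injective hij)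
    exact_mod_cast h_eq
  have hlog : ∀ k ∈ Finset.Icc 1 M, ‖((Real.log k : ℝ) : ℂ)‖ ≤ L := by
    intro k hk
    rw [Finset.mem_Icc] at hk
    have hk_pos : (0 : ℝ) < k := by exact_mod_cast hk.1
    rw [Complex.norm_real, Real.norm_of_nonneg (Real.log_natCast_nonneg k)]
    exact Real.log_le_log hk_pos (by exact_mod_cast hk.2)
  obtain ⟨h, hh, hgh⟩ := exists_entire_factor
    ((Finset.Icc 1 M).image fun k : ℕ => ((Real.log k : ℝ) : ℂ)) hg (by
      simp only [Finset.mem_image, Finset.mem_Icc, forall_exists_index, and_imp]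
      rintro _ k hk - rfl
      exact hzero k hk)
  simp only [Finset.prod_image hinj] at hgh
  have hexp : Real.exp (R * (4 * L)) = (M : ℝ) ^ (4 * R) := by
    rw [← Real.exp_log hM_pos, ← Real.exp_nat_mul, ← hL]
    push_cast
    ring_nf
  have hh_sphere : ∀ w ∈ frontier (Metric.ball (0 : ℂ) (4 * L)),
      ‖h w‖ ≤ C * (M : ℝ) ^ (4 * R) / (3 * L) ^ M := by
    intro w hw
    rw [frontier_ball _ (by positivity), mem_sphere_zero_iff_norm] at hw
    rw [le_div_iff₀ (by positivity)]
    have hprod : (3 * L) ^ M ≤ ‖∏ k ∈ Finset.Icc 1 M, (w - ((Real.log k : ℝ) : ℂ))‖ := by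
      rw [norm_prod]
      calc (3 * L) ^ M = ∏ _k ∈ Finset.Icc 1 M, 3 * L := by simp
        _ ≤ _ := Finset.prod_le_prod (fun _ _ => by positivity) fun k hk => by
          have := norm_sub_norm_le w ((Real.log k : ℝ) : ℂ)
          linarith [hlog k hk]
    calc ‖h w‖ * (3 * L) ^ M
        ≤ ‖h w‖ * ‖∏ k ∈ Finset.Icc 1 M, (w - ((Real.log k : ℝ) : ℂ))‖ := by gcongr
      _ = ‖g w‖ := by rw [hgh w, norm_mul, mul_comm]
      _ ≤ C * Real.exp (R * (4 * L)) := hw ▸ hbound w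
      _ = _ := by rw [hexp]
  have hh_z : ‖h z‖ ≤ C * (M : ℝ) ^ (4 * R) / (3 * L) ^ M := by
    refine Complex.norm_le_of_forall_mem_frontier_norm_le Metric.isBounded_ball
      hh.diffContOnCl hh_sphere (subset_closure ?_)
    rw [mem_ball_zero_iff]
    linarith
  have hprod : ‖∏ k ∈ Finset.Icc 1 M, (z - ((Real.log k : ℝ) : ℂ))‖ ≤ (3 * L * (1 / 2)) ^ M := by
    rw [norm_prod]
    calc _ ≤ ∏ _k ∈ Finset.Icc 1 M, (3 * L * (1 / 2)) :=
          Finset.prod_le_prod (fun _ _ => norm_nonneg _) fun k hk => by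
            have := norm_sub_le z ((Real.log k : ℝ) : ℂ)
            linarith [hlog k hk]
      _ = _ := by simp
  calc ‖g z‖ = ‖∏ k ∈ Finset.Icc 1 M, (z - ((Real.log k : ℝ) : ℂ))‖ * ‖h z‖ := by
        rw [hgh z, norm_mul]
    _ ≤ (3 * L * (1 / 2)) ^ M * (C * (M : ℝ) ^ (4 * R) / (3 * L) ^ M) := by gcongr
    _ = _ := by
      rw [mul_pow (3 * L)]
      field_simp

/-- An entire function of exponential type vanishing at the logarithms of all positive integers
is zero. -/
lemma eq_zero_of_zeros_log {g : ℂ → ℂ} (hg : Differentiable ℂ g) {C : ℝ} {R : ℕ}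
    (hbound : ∀ z, ‖g z‖ ≤ C * Real.exp (R * ‖z‖))
    (hzero : ∀ k : ℕ, 1 ≤ k → g (Real.log k) = 0) (z : ℂ) : g z = 0 := by
  have hlim : Tendsto (fun M : ℕ => C * ((M : ℝ) ^ (4 * R) * (1 / 2) ^ M)) atTop (𝓝 0) := by
    simpa using (tendsto_pow_const_mul_const_pow_of_abs_lt_one (4 * R)
      (r := 1 / 2) (by norm_num [abs_of_pos])).const_mul C
  have hlog : Tendsto (fun M : ℕ => Real.log M / 2) atTop atTop :=
    (Real.tendsto_log_atTop.comp tendsto_natCast_atTop_atTop).atTop_div_const (by norm_num)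
  refine norm_le_zero_iff.mp (ge_of_tendsto hlim ?_)
  filter_upwards [hlog.eventually_ge_atTop ‖z‖, eventually_ge_atTop 2] with M hM hM2
  exact norm_le_of_zeros_log hg hbound hzero hM2 hM

/-- The exponential in `C(K, ℂ)` is computed pointwise. -/
lemma ContinuousMap.exp_apply_complex {K : Type*} [TopologicalSpace K] [CompactSpace K]
    (f : C(K, ℂ)) (x : K) : NormedSpace.exp f x = Complex.exp (f x) := by
  let _ : NormedAlgebra ℚ C(K, ℂ) := NormedAlgebra.restrictScalars ℚ ℂ C(K, ℂ)
  have := NormedSpace.map_exp (ContinuousMap.evalAlgHom ℂ ℂ x) (continuous_eval_const x) f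
  rw [Complex.exp_eq_exp_ℂ]
  exact this

/-- A functional on `C(K, ℂ)` which annihilates the functions `k ^ (-f)`, `k ≥ 1`, annihilates
every power of `f`. -/
lemma map_pow_eq_zero_of_map_exp_log {K : Type*} [TopologicalSpace K] [CompactSpace K]
    (f : C(K, ℂ)) (φ : C(K, ℂ) →L[ℂ] ℂ)
    (hφ : ∀ k : ℕ, 1 ≤ k → φ (NormedSpace.exp (((Real.log k : ℝ) : ℂ) • f)) = 0) (j : ℕ) :
    φ (f ^ j) = 0 := by
  have hderiv : ∀ (j : ℕ) (u : ℂ),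
      HasDerivAt (fun u : ℂ => φ (NormedSpace.exp (u • f) * f ^ j))
        (φ (NormedSpace.exp (u • f) * f ^ (j + 1))) u := by
    intro j u
    have := φ.hasFDerivAt.comp_hasDerivAt u
      ((hasDerivAt_exp_smul_const (𝕂 := ℂ) f u).mul_const (f ^ j))
    rwa [mul_assoc, ← pow_succ'] at this
  have hexp : ∀ u : ℂ, φ (NormedSpace.exp (u • f)) = 0 := by
    refine eq_zero_of_zeros_log (C := ‖φ‖) (R := ⌈‖f‖⌉₊)
      (fun u => ?_) (fun u => ?_) hφ
    · simpa using (hderiv 0 u).differentiableAt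
    · refine (φ.le_opNorm _).trans ?_
      gcongr
      rw [ContinuousMap.norm_le _ (Real.exp_nonneg _)]
      intro x
      rw [ContinuousMap.exp_apply_complex]
      refine (Complex.norm_exp_le_exp_norm _).trans (Real.exp_le_exp.mpr ?_)
      rw [ContinuousMap.smul_apply, norm_smul, mul_comm]
      gcongr
      exact (f.norm_coe_le_norm x).trans (Nat.le_ceil _)
  have hall : ∀ (j : ℕ) (u : ℂ), φ (NormedSpace.exp (u • f) * f ^ j) = 0 := by
    intro j
    induction j with
    | zero => simpa using hexp
    | succ j ih =>
      intro u
      refine (hderiv j u).unique ?_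
      simpa only [ih] using hasDerivAt_const u (0 : ℂ)
  simpa using hall j 0

/-- A vector annihilated by all continuous functionals that annihilate a subspace lies in the
closure of the subspace. -/
lemma mem_topologicalClosure_of_forall_dual {E : Type*} [NormedAddCommGroup E] [NormedSpace ℂ E]
    (V : Submodule ℂ E) {x : E} (h : ∀ φ : E →L[ℂ] ℂ, (∀ v ∈ V, φ v = 0) → φ x = 0) :
    x ∈ V.topologicalClosure := by
  by_contra hx
  have : IsClosed (V.topologicalClosure : Set E) := V.isClosed_topologicalClosure
  obtain ⟨ψ, hψ⟩ := SeparatingDual.exists_ne_zero (R := ℂ)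
    (mt (Submodule.Quotient.mk_eq_zero V.topologicalClosure).mp hx)
  refine hψ (h (ψ.comp V.topologicalClosure.mkQL) fun v hv => ?_)
  have : V.topologicalClosure.mkQL v = 0 :=
    (Submodule.Quotient.mk_eq_zero _).mpr (V.le_topologicalClosure hv)
  rw [ContinuousLinearMap.comp_apply, this, map_zero]

/-- Dirichlet polynomials approximate algebraic polynomials uniformly on compact sets. -/
lemma exists_dirichletPolynomial_near {K : Set ℂ} (hK : IsCompact K) (p : ℂ[X]) {ε : ℝ}
    (hε : 0 < ε) :
    ∃ D : ℂ → ℂ, IsDirichletPolynomial D ∧ ∀ z ∈ K, ‖D z - p.eval z‖ < ε := by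
  have : CompactSpace K := isCompact_iff_compactSpace.mp hK
  let f : C(K, ℂ) := ⟨fun z => -(z : ℂ), by fun_prop⟩
  let v : ℕ → C(K, ℂ) := fun k => NormedSpace.exp (((Real.log (k + 1 : ℕ) : ℝ) : ℂ) • f)
  have hv : ∀ k (z : K), v k z = ((k + 1 : ℕ) : ℂ) ^ (-(z : ℂ)) := by
    intro k z
    rw [ContinuousMap.exp_apply_complex, Complex.cpow_def_of_ne_zero (by exact_mod_cast k.succ_ne_zero),
      Complex.natCast_log]
    rfl
  let V := Submodule.span ℂ (Set.range v)
  have hpow : ∀ j, f ^ j ∈ V.topologicalClosure := fun j =>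
    mem_topologicalClosure_of_forall_dual V fun φ hφ =>
      map_pow_eq_zero_of_map_exp_log f φ (fun k hk => by
        obtain ⟨k, rfl⟩ := Nat.exists_eq_add_of_le' hk
        exact hφ _ (Submodule.subset_span ⟨k, rfl⟩)) j
  have hp : aeval f (p.comp (-X)) ∈ V.topologicalClosure := by
    rw [aeval_eq_sum_range]
    exact Submodule.sum_mem _ fun j _ => Submodule.smul_mem _ _ (hpow j)
  obtain ⟨g, hgV, hg⟩ := Metric.mem_closure_iff.mp hp ε hε
  obtain ⟨c, rfl⟩ := Finsupp.mem_span_range_iff_exists_finsupp.mp hgV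
  refine ⟨fun z => ∑ k ∈ Finset.Icc 1 (c.support.sup id + 1), c (k - 1) * (k : ℂ) ^ (-z),
    ⟨_, _, fun _ => rfl⟩, fun z hz => ?_⟩
  have hsum : (c.sum fun i a => a • v i) ⟨z, hz⟩ =
      ∑ k ∈ Finset.Icc 1 (c.support.sup id + 1), c (k - 1) * (k : ℂ) ^ (-z) := by
    rw [Finsupp.sum_of_support_subset c (s := Finset.range (c.support.sup id + 1))
      (fun i hi => Finset.mem_range_succ_iff.mpr (Finset.le_sup (f := id) hi)) _ (by simp),
      Finset.range_eq_Ico, ContinuousMap.sum_apply, ← Finset.Ico_add_one_right_eq_Icc,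
      ← Finset.sum_Ico_add' _ 0 _ 1]
    refine Finset.sum_congr rfl fun i _ => ?_
    rw [ContinuousMap.smul_apply, hv]
    simp
  have heval : aeval f (p.comp (-X)) ⟨z, hz⟩ = p.eval z := by
    have := aeval_algHom_apply (ContinuousMap.evalAlgHom ℂ ℂ (⟨z, hz⟩ : K)) f (p.comp (-X))
    refine this.symm.trans ?_
    rw [coe_aeval_eq_eval, eval_comp]
    simp [f]
  beta_reduce
  rw [← hsum, ← heval, ← dist_eq_norm, dist_comm]
  exact (ContinuousMap.dist_apply_le_dist _).trans_lt hg

/-- If `a` can be joined to infinity off the compact set `K`, then `w ↦ (w - a)⁻¹` is uniformly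
approximable on `K` by polynomials. -/
lemma exists_polynomial_near_inv_sub {K U : Set ℂ} (hK : IsCompact K) (hU : IsPreconnected U)
    (hU_unbounded : ¬ Bornology.IsBounded U) (hKU : Disjoint K U) {a : ℂ} (ha : a ∈ U) {ε : ℝ}
    (hε : 0 < ε) : ∃ p : ℂ[X], ∀ w ∈ K, ‖p.eval w - (w - a)⁻¹‖ < ε := by
  have : CompactSpace K := isCompact_iff_compactSpace.mp hK
  let f : C(K, ℂ) := ⟨fun w => (w : ℂ), by fun_prop⟩
  let S := (aeval f : ℂ[X] →ₐ[ℂ] C(K, ℂ)).range.topologicalClosure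
  have hS : IsClosed (S : Set C(K, ℂ)) := Subalgebra.isClosed_topologicalClosure _
  let x : S := ⟨f, Subalgebra.le_topologicalClosure _ ⟨X, by simp⟩⟩
  have hspec : U ⊆ (spectrum ℂ (x : C(K, ℂ)))ᶜ := by
    intro u hu
    rw [ContinuousMap.spectrum_eq_range]
    rintro ⟨w, rfl⟩
    exact hKU.notMem_of_mem_left w.2 hu
  have ha_spec : a ∉ spectrum ℂ x := fun h => hU_unbounded
    ((Subalgebra.spectrum_isBounded_connectedComponentIn S x h).subset
      (hU.subset_connectedComponentIn ha hspec))
  rw [spectrum.notMem_iff] at ha_spec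
  obtain ⟨y, hy⟩ := ha_spec.exists_left_inv
  have hy_apply : ∀ w : K, -(y : C(K, ℂ)) w = ((w : ℂ) - a)⁻¹ := by
    intro w
    have h1 : (y : C(K, ℂ)) * (algebraMap ℂ C(K, ℂ) a - f) = 1 := congrArg Subtype.val hy
    have h2 : (y : C(K, ℂ)) w * (a - w) = 1 := congrArg (fun F : C(K, ℂ) => F w) h1
    exact eq_inv_of_mul_eq_one_left (by linear_combination h2)
  obtain ⟨_, ⟨p, rfl⟩, hp⟩ := Metric.mem_closure_iff.mp (-y).2 ε hε
  refine ⟨p, fun w hw => ?_⟩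
  have heval : aeval f p ⟨w, hw⟩ = p.eval w := by
    have := aeval_algHom_apply (ContinuousMap.evalAlgHom ℂ ℂ (⟨w, hw⟩ : K)) f p
    refine this.symm.trans ?_
    rw [coe_aeval_eq_eval]
    rfl
  rw [← hy_apply ⟨w, hw⟩, ← heval, ← dist_eq_norm, dist_comm]
  exact (ContinuousMap.dist_apply_le_dist (⟨w, hw⟩ : K)).trans_lt hp

/-- The strip `0 < Im w < δ` is connected and unbounded, so the pole at any of its points can be
pushed to infinity. -/
lemma exists_polynomial_near_inv_sub_of_strip (r : ℝ) {δ ε : ℝ} (hδ : 0 < δ) (hε : 0 < ε) :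
    ∃ p : ℂ[X], ∀ w : ℂ, ‖w‖ ≤ r → (w.im ≤ 0 ∨ δ ≤ w.im) →
      ‖p.eval w - (w - (δ / 2 : ℝ) * I)⁻¹‖ < ε := by
  let U : Set ℂ := Complex.im ⁻¹' Set.Ioo 0 δ
  have hU : IsPreconnected U := ((convex_Ioo 0 δ).is_linear_preimage
    Complex.imLm.isLinear).isPreconnected
  have hU_open : IsOpen U := isOpen_Ioo.preimage Complex.continuous_im
  have hU_unbounded : ¬ Bornology.IsBounded U := by
    intro h
    obtain ⟨C, hC⟩ := h.exists_norm_le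
    have h1 := hC (((|C| + 1 : ℝ) : ℂ) + (δ / 2 : ℝ) * I) (by simp [U, hδ])
    have h2 := (Complex.abs_re_le_norm _).trans h1
    simp only [add_re, ofReal_re, re_ofReal_mul, I_re, mul_zero, add_zero] at h2
    linarith [le_abs_self (|C| + 1), le_abs_self C]
  obtain ⟨p, hp⟩ := exists_polynomial_near_inv_sub
    (K := Metric.closedBall 0 r ∩ Uᶜ) ((isCompact_closedBall 0 r).inter_right hU_open.isClosed_compl)
    hU hU_unbounded (Set.disjoint_left.mpr fun _ h => h.2) (a := (δ / 2 : ℝ) * I)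
    (by simp [U, hδ]) hε
  refine ⟨p, fun w hw h => hp w ⟨by simpa using hw, fun hwU => ?_⟩⟩
  rcases h with h | h
  · exact h.not_gt hwU.1
  · exact h.not_gt hwU.2

/-- There are polynomials converging pointwise to `w⁻¹` off `0` and to infinity at `0`. -/
lemma exists_polynomial_tendsto_inv :
    ∃ q : ℕ → ℂ[X], (∀ w : ℂ, w ≠ 0 → Tendsto (fun n => (q n).eval w) atTop (𝓝 w⁻¹)) ∧
      Tendsto (fun n => ‖(q n).eval 0‖) atTop atTop := by
  let δ : ℕ → ℝ := fun n => 1 / (n + 1)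
  have hδ : ∀ n, 0 < δ n := fun n => Nat.one_div_pos_of_nat
  have hδ_lim : Tendsto δ atTop (𝓝 0) := tendsto_one_div_add_atTop_nhds_zero_nat
  let a : ℕ → ℂ := fun n => (δ n / 2 : ℝ) * I
  have ha_lim : Tendsto a atTop (𝓝 0) := by
    have : Tendsto (fun n => δ n / 2) atTop (𝓝 0) := by simpa using hδ_lim.div_const 2
    simpa [a] using ((Complex.continuous_ofReal.tendsto 0).comp this).mul_const I
  choose q hq using fun n : ℕ =>
    exists_polynomial_near_inv_sub_of_strip n (hδ n) (hδ n)
  have hsub : ∀ w : ℂ, Tendsto (fun n => (q n).eval w - (w - a n)⁻¹) atTop (𝓝 0) := by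
    intro w
    refine squeeze_zero_norm' ?_ hδ_lim
    have h_im : ∀ᶠ n in atTop, w.im ≤ 0 ∨ δ n ≤ w.im := by
      rcases le_or_gt w.im 0 with h | h
      · exact Eventually.of_forall fun _ => Or.inl h
      · filter_upwards [hδ_lim.eventually_le_const h] with n hn using Or.inr hn
    filter_upwards [h_im, tendsto_natCast_atTop_atTop.eventually_ge_atTop ‖w‖] with n h1 h2
    exact (hq n w h2 h1).le
  refine ⟨q, fun w hw => ?_, ?_⟩
  · have h1 : Tendsto (fun n => (w - a n)⁻¹) atTop (𝓝 w⁻¹) := by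
      simpa using (tendsto_const_nhds.sub ha_lim).inv₀ (by simpa using hw)
    simpa using (hsub w).add h1
  · have h1 : Tendsto (fun n => ‖(0 - a n)⁻¹‖) atTop atTop := by
      have : ∀ n, ‖(0 - a n)⁻¹‖ = 2 * ((n : ℝ) + 1) := by
        intro n
        have hpos : (0 : ℝ) < n + 1 := by positivity
        simp only [a, δ, zero_sub, norm_inv, norm_neg, norm_mul, Complex.norm_I, mul_one,
          Complex.norm_real, Real.norm_eq_abs]
        rw [abs_of_pos (by positivity)]
        field_simp
      simp only [this]
      exact (tendsto_atTop_add_const_right _ 1 tendsto_natCast_atTop_atTop).const_mul_atTop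
        (by norm_num)
    refine tendsto_atTop_mono' _ ?_ (tendsto_atTop_add_const_right _ (-1) h1)
    have h2 : ∀ᶠ n in atTop, ‖(q n).eval 0 - (0 - a n)⁻¹‖ ≤ 1 :=
      (tendsto_zero_iff_norm_tendsto_zero.mp (hsub 0)).eventually_le_const one_pos
    filter_upwards [h2] with n hn
    have := norm_sub_norm_le ((0 - a n)⁻¹) ((q n).eval 0)
    rw [norm_sub_rev] at this
    linarith

/-- The partial sums of the Taylor series of an entire function are polynomials converging to it
pointwise. -/
lemma Differentiable.exists_polynomial_tendsto {g : ℂ → ℂ} (hg : Differentiable ℂ g) :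
    ∃ T : ℕ → ℂ[X], ∀ z, Tendsto (fun n => (T n).eval z) atTop (𝓝 (g z)) := by
  refine ⟨fun n => ∑ k ∈ Finset.range n, C ((k.factorial : ℂ)⁻¹ * iteratedDeriv k g 0) * X ^ k,
    fun z => ?_⟩
  refine (Complex.hasSum_taylorSeries_of_entire hg 0 z).tendsto_sum_nat.congr fun n => ?_
  rw [eval_finsetSum]
  refine Finset.sum_congr rfl fun k _ => ?_
  simp only [smul_eq_mul, sub_zero, eval_mul, eval_C, eval_pow, eval_X]
  ring

/-- If `u` tends to infinity in norm and `v - u` converges, then `v` tends to infinity in norm. -/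
lemma tendsto_norm_atTop_of_sub_tendsto {u v : ℕ → ℂ} {c : ℂ}
    (hu : Tendsto (fun n => ‖u n‖) atTop atTop)
    (huv : Tendsto (fun n => v n - u n) atTop (𝓝 c)) :
    Tendsto (fun n => ‖v n‖) atTop atTop := by
  refine tendsto_atTop_mono (fun n => ?_) (hu.atTop_add huv.norm.neg)
  have := norm_sub_norm_le (u n) (v n)
  rw [norm_sub_rev] at this
  linarith

/-- There exist a sequence of algebraic polynomials `P_n` and a sequence of Dirichlet
polynomials `D_n` converging pointwise to `ζ` away from `1`, with `|P_n(1)| → ∞` and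
`|D_n(1)| → ∞`. -/
theorem zeta_pointwise_approx :
    ∃ (P : ℕ → Polynomial ℂ) (D : ℕ → ℂ → ℂ),
      (∀ n, IsDirichletPolynomial (D n)) ∧
      (∀ z : ℂ, z ≠ 1 →
        Tendsto (fun n => (P n).eval z) atTop (nhds (riemannZeta z)) ∧
        Tendsto (fun n => D n z) atTop (nhds (riemannZeta z))) ∧
      Tendsto (fun n => ‖(P n).eval 1‖) atTop atTop ∧
      Tendsto (fun n => ‖D n 1‖) atTop atTop := by
  obtain ⟨q, hq, hq_zero⟩ := exists_polynomial_tendsto_inv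
  obtain ⟨T, hT⟩ := differentiable_riemannZeta₀.exists_polynomial_tendsto
  let P : ℕ → ℂ[X] := fun n => (q n).comp (X - C 1) + T n
  have hP_eval : ∀ n z, (P n).eval z = (q n).eval (z - 1) + (T n).eval z := by
    intro n z
    simp [P, eval_comp]
  have hP : ∀ z : ℂ, z ≠ 1 → Tendsto (fun n => (P n).eval z) atTop (𝓝 (riemannZeta z)) := by
    intro z hz
    simp only [hP_eval, riemannZeta_eq_inv_sub_add hz]
    exact (hq _ (sub_ne_zero.mpr hz)).add (hT z)
  have hP_one : Tendsto (fun n => ‖(P n).eval 1‖) atTop atTop :=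
    tendsto_norm_atTop_of_sub_tendsto hq_zero (by simpa [hP_eval] using hT 1)
  choose D hD hDP using fun n : ℕ => exists_dirichletPolynomial_near
    (isCompact_closedBall (0 : ℂ) n) (P n) (Nat.one_div_pos_of_nat (α := ℝ) (n := n))
  have hsub : ∀ z, Tendsto (fun n => D n z - (P n).eval z) atTop (𝓝 0) := by
    intro z
    refine squeeze_zero_norm' ?_ (tendsto_one_div_add_atTop_nhds_zero_nat (𝕜 := ℝ))
    filter_upwards [tendsto_natCast_atTop_atTop.eventually_ge_atTop ‖z‖] with n hn
    exact (hDP n z (by simpa using hn)).le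
  refine ⟨P, D, hD, fun z hz => ⟨hP z hz, ?_⟩, hP_one,
    tendsto_norm_atTop_of_sub_tendsto hP_one (hsub 1)⟩
  simpa using (hsub z).add (hP z hz)
end

section
/- Let K be a compact subset of ℂ. Then ℂ \ K is connected if and only if every function that is continuous on K and holomorphic on the interior of K is a uniform limit on K of algebraic polynomials (i.e. P(K) = A(K)). -/
open Complex Set

/-- A function on `K` is polynomially approximable if it agrees on `K` with an element of the
closure `P(K)` of the polynomial functions. -/
def PolyApprox (K : Set ℂ) [CompactSpace K] (f : ℂ → ℂ) : Prop :=
  ∃ F ∈ (polynomialFunctions K).topologicalClosure, ∀ z : K, F z = f z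

namespace PolyApprox

variable {K : Set ℂ} [CompactSpace K] {f g : ℂ → ℂ}

theorem congr (hf : PolyApprox K f) (h : ∀ z ∈ K, f z = g z) : PolyApprox K g := by
  obtain ⟨F, hF, hFf⟩ := hf
  exact ⟨F, hF, fun z => (hFf z).trans (h z z.2)⟩

theorem add (hf : PolyApprox K f) (hg : PolyApprox K g) : PolyApprox K (fun z => f z + g z) := by
  obtain ⟨F, hF, hFf⟩ := hf
  obtain ⟨G, hG, hGg⟩ := hg
  exact ⟨F + G, add_mem hF hG, fun z => by simp [hFf, hGg]⟩

theorem mul (hf : PolyApprox K f) (hg : PolyApprox K g) : PolyApprox K (fun z => f z * g z) := by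
  obtain ⟨F, hF, hFf⟩ := hf
  obtain ⟨G, hG, hGg⟩ := hg
  exact ⟨F * G, mul_mem hF hG, fun z => by simp [hFf, hGg]⟩

theorem eval (p : Polynomial ℂ) : PolyApprox K (fun z => p.eval z) :=
  ⟨p.toContinuousMapOn K, (polynomialFunctions K).le_topologicalClosure ⟨p, by simp, rfl⟩,
    fun z => by simp⟩

theorem const (c : ℂ) : PolyApprox K (fun _ => c) := by
  simpa using! eval (K := K) (Polynomial.C c)

theorem id : PolyApprox K (fun z => z) := by
  simpa using! eval (K := K) Polynomial.X

theorem sum {ι : Type*} (s : Finset ι) {f : ι → ℂ → ℂ} (hf : ∀ i ∈ s, PolyApprox K (f i)) :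
    PolyApprox K (fun z => ∑ i ∈ s, f i z) := by
  classical
  induction s using Finset.induction_on with
  | empty => simpa using const 0
  | insert a s ha ih =>
    simp only [Finset.sum_insert ha]
    exact (hf a (by simp)).add (ih fun i hi => hf i (by simp [hi]))

theorem pow (hf : PolyApprox K f) (n : ℕ) : PolyApprox K (fun z => f z ^ n) := by
  obtain ⟨F, hF, hFf⟩ := hf
  exact ⟨F ^ n, pow_mem hF n, fun z => by simp [hFf]⟩

theorem continuousOn (hf : PolyApprox K f) : ContinuousOn f K := by
  obtain ⟨F, -, hFf⟩ := hf
  rw [continuousOn_iff_continuous_domRestrict]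
  exact F.continuous.congr hFf

/-- A uniform limit of polynomially approximable functions is polynomially approximable. -/
theorem of_forall_exists (hf : ∀ ε > 0, ∃ g, PolyApprox K g ∧ ∀ z ∈ K, ‖f z - g z‖ ≤ ε) :
    PolyApprox K f := by
  have hcont : ContinuousOn f K := by
    choose! g hg using hf
    refine TendstoUniformlyOn.continuousOn (p := nhdsWithin (0 : ℝ) (Ioi 0)) (F := g) ?_ ?_
    · rw [Metric.tendstoUniformlyOn_iff]
      intro ε hε
      have : Ioo (0 : ℝ) ε ∈ nhdsWithin (0 : ℝ) (Ioi 0) := Ioo_mem_nhdsGT hε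
      filter_upwards [this] with δ hδ z hz
      rw [dist_eq_norm]
      exact ((hg δ hδ.1).2 z hz).trans_lt hδ.2
    · exact Filter.Eventually.frequently (f := nhdsWithin (0 : ℝ) (Ioi 0))
        (eventually_mem_nhdsWithin.mono fun δ hδ => (hg δ hδ).1.continuousOn)
  refine ⟨⟨K.domRestrict f, hcont.domRestrict⟩, ?_, fun z => rfl⟩
  rw [← SetLike.mem_coe, ← (polynomialFunctions K).isClosed_topologicalClosure.closure_eq,
    Metric.mem_closure_iff]
  intro ε hε
  obtain ⟨g, ⟨G, hG, hGg⟩, hfg⟩ := hf (ε / 2) (by positivity)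
  refine ⟨G, hG, (ContinuousMap.dist_le (by positivity)).2 (fun z => ?_) |>.trans_lt
    (half_lt_self hε)⟩
  rw [dist_eq_norm, hGg]
  exact hfg z z.2

theorem exists_polynomial (hf : PolyApprox K f) {ε : ℝ} (hε : 0 < ε) :
    ∃ p : Polynomial ℂ, ∀ z ∈ K, ‖f z - p.eval z‖ < ε := by
  obtain ⟨F, hF, hFf⟩ := hf
  obtain ⟨G, hG, hFG⟩ := Metric.mem_closure_iff.1
    (show F ∈ closure (polynomialFunctions K : Set C(K, ℂ)) from hF) ε hε
  obtain ⟨p, -, rfl⟩ := hG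
  refine ⟨p, fun z hz => ?_⟩
  have := (ContinuousMap.dist_apply_le_dist (⟨z, hz⟩ : K)).trans_lt hFG
  rw [dist_eq_norm, hFf] at this
  simpa using! this

/-- Composition with a function holomorphic on a disc containing the values. -/
theorem comp_of_differentiableOn (hf : PolyApprox K f) {φ : ℂ → ℂ} {ρ R : ℝ} (hρR : ρ < R)
    (hφ : DifferentiableOn ℂ φ (Metric.ball 0 R)) (hfρ : ∀ z ∈ K, ‖f z‖ ≤ ρ) :
    PolyApprox K (fun z => φ (f z)) := by
  by_cases hR : 0 < R
  swap
  · have : ∀ z ∈ K, False := fun z hz => by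
      linarith [hfρ z hz, norm_nonneg (f z), not_lt.1 hR]
    exact (const 0).congr fun z hz => (this z hz).elim
  obtain ⟨R', h1, h2⟩ := exists_between (max_lt hρR hR)
  obtain ⟨R'', h3, h4⟩ := exists_between h2
  have hR' : 0 < R' := (le_max_right _ _).trans_lt h1
  lift R' to NNReal using hR'.le
  lift R'' to NNReal using (hR'.trans h3).le
  have hd : DifferentiableOn ℂ φ (Metric.closedBall 0 (R'' : ℝ)) :=
    hφ.mono (Metric.closedBall_subset_ball h4)
  have hs := hd.hasFPowerSeriesOnBall (by exact_mod_cast hR'.trans h3)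
  have hu := hs.tendstoUniformlyOn (r' := R') (by exact_mod_cast h3)
  refine of_forall_exists fun ε hε => ?_
  obtain ⟨n, hn⟩ := (Metric.tendstoUniformlyOn_iff.1 hu ε hε).exists
  refine ⟨fun z => (cauchyPowerSeries φ 0 R'').partialSum n (f z), ?_, fun z hz => ?_⟩
  · simp only [FormalMultilinearSeries.partialSum, FormalMultilinearSeries.apply_eq_pow_smul_coeff,
      smul_eq_mul]
    exact sum _ fun i _ => (hf.pow i).mul (const _)
  · have := hn (f z) (by
      simpa using (hfρ z hz).trans_lt ((le_max_left _ _).trans_lt h1))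
    rw [dist_eq_norm, zero_add] at this
    exact this.le

end PolyApprox

/-- On a preconnected set, a locally constant property which holds at one point holds
everywhere. -/
theorem forall_of_isPreconnected {U : Set ℂ} (hU : IsPreconnected U) {P : ℂ → Prop}
    (h : ∀ x ∈ U, ∀ᶠ y in nhdsWithin x U, (P x ↔ P y)) {a : ℂ} (ha : a ∈ U) (hPa : P a) :
    ∀ x ∈ U, P x := fun _ hx =>
  (hU.induction₂ (fun x y => (P x ↔ P y)) h (fun _ _ _ _ _ _ h₁ h₂ => h₁.trans h₂)
    (fun _ _ _ _ h => h.symm) ha hx).1 hPa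

theorem PolyApprox.sub_inv {K : Set ℂ} [CompactSpace K] (hc : IsPreconnected Kᶜ) {p : ℂ}
    (hp : p ∉ K) : PolyApprox K (fun z => (z - p)⁻¹) := by
  have hKc : IsClosed K := (isCompact_iff_compactSpace.2 ‹_›).isClosed
  have hφ : DifferentiableOn ℂ (fun x : ℂ => (1 - x)⁻¹) (Metric.ball 0 1) := by
    intro x hx
    refine DifferentiableAt.differentiableWithinAt ?_
    refine DifferentiableAt.inv (by fun_prop) ?_
    rintro h
    rw [← sub_eq_zero.1 h] at hx
    simp at hx
  have step : ∀ p q : ℂ, p ∉ K → PolyApprox K (fun z => (z - p)⁻¹) →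
      (∀ z ∈ K, ‖q - p‖ ≤ ‖z - p‖ / 2) → PolyApprox K (fun z => (z - q)⁻¹) := by
    intro p q hp hap hq
    have h1 : PolyApprox K (fun z => (1 - (q - p) * (z - p)⁻¹)⁻¹) := by
      refine ((const (q - p)).mul hap).comp_of_differentiableOn (ρ := 1 / 2) (by norm_num) hφ ?_
      intro z hz
      have hzp : 0 < ‖z - p‖ := norm_pos_iff.2 (sub_ne_zero.2 fun h => hp (h ▸ hz))
      rw [norm_mul, norm_inv, ← div_eq_mul_inv, div_le_iff₀ hzp]
      linarith [hq z hz]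
    refine (hap.mul h1).congr fun z hz => ?_
    have hzp : z - p ≠ 0 := sub_ne_zero.2 fun h => hp (h ▸ hz)
    rw [← mul_inv]
    congr 1
    field_simp
    ring
  obtain ⟨M, hM⟩ : ∃ M : ℝ, ∀ z ∈ K, ‖z‖ ≤ M :=
    (isCompact_iff_compactSpace.2 ‹_›).isBounded.exists_norm_le
  set a : ℂ := ((2 * |M| + 1 : ℝ) : ℂ) with ha
  have hna : ‖a‖ = 2 * |M| + 1 := by
    rw [ha, Complex.norm_real, Real.norm_of_nonneg (by positivity)]
  have hM2 : ∀ z ∈ K, ‖z‖ ≤ ‖a‖ / 2 := fun z hz => by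
    rw [hna]; linarith [hM z hz, le_abs_self M]
  have ha0 : 0 < ‖a‖ := by rw [hna]; positivity
  have haK : a ∉ K := fun h => by linarith [hM2 a h]
  refine forall_of_isPreconnected hc (P := fun p => PolyApprox K (fun z => (z - p)⁻¹)) ?_ haK ?_
    p hp
  · intro x hx
    obtain ⟨η, hη, hball⟩ := Metric.isOpen_iff.1 hKc.isOpen_compl x hx
    have hfar : ∀ z ∈ K, η ≤ ‖z - x‖ := fun z hz => by
      by_contra! hlt
      exact hball (by simpa [dist_eq_norm] using hlt) hz
    filter_upwards [mem_nhdsWithin_of_mem_nhds (Metric.ball_mem_nhds x (by positivity :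
      0 < η / 3)), self_mem_nhdsWithin] with y hy hyK
    have hyx : ‖y - x‖ < η / 3 := by simpa [dist_eq_norm] using hy
    constructor
    · intro h
      exact step x y hx h fun z hz => by linarith [hfar z hz]
    · intro h
      refine step y x hyK h fun z hz => ?_
      rw [norm_sub_rev]
      have : ‖z - x‖ ≤ ‖z - y‖ + ‖y - x‖ := norm_sub_le_norm_sub_add_norm_sub ..
      linarith [hfar z hz]
  · have h1 : PolyApprox K (fun z => (1 - a⁻¹ * z)⁻¹) := by
      refine ((const a⁻¹).mul id).comp_of_differentiableOn (ρ := 1 / 2) (by norm_num) hφ ?_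
      intro z hz
      rw [norm_mul, norm_inv, inv_mul_le_iff₀ ha0]
      linarith [hM2 z hz]
    refine ((const (-a⁻¹)).mul h1).congr fun z hz => ?_
    have : a ≠ 0 := norm_pos_iff.1 ha0
    rw [neg_mul, ← mul_inv, mul_sub, mul_inv_cancel_left₀ this, mul_one, ← inv_neg, neg_sub]

open WeakDual in
/-- If `Kᶜ` is connected, the algebra `P(K)` is inverse closed: its characters are the evaluations
at points of `K`. -/
theorem PolyApprox.inv {K : Set ℂ} [CompactSpace K] (hc : IsPreconnected Kᶜ) {f : ℂ → ℂ}
    (hf : PolyApprox K f) (h0 : ∀ z ∈ K, f z ≠ 0) : PolyApprox K (fun z => (f z)⁻¹) := by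
  obtain ⟨F, hF, hFf⟩ := hf
  set B := (polynomialFunctions K).topologicalClosure with hB
  have : CompleteSpace B := (polynomialFunctions K).isClosed_topologicalClosure.completeSpace_coe
  suffices hu : IsUnit (⟨F, hF⟩ : B) by
    obtain ⟨G, hG⟩ := hu.exists_right_inv
    refine ⟨G, G.2, fun z => ?_⟩
    have h1 : F z * (G : C(K, ℂ)) z = 1 := by
      simpa using! congrArg (fun H : B => (H : C(K, ℂ)) z) hG
    change (G : C(K, ℂ)) z = (f z)⁻¹
    rw [← hFf]
    exact eq_inv_of_mul_eq_one_right h1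
  by_contra hu
  obtain ⟨φ, hφ⟩ := CharacterSpace.exists_apply_eq_zero hu
  have hmem : ∀ p : Polynomial ℂ, p.toContinuousMapOn K ∈ B := fun p =>
    (polynomialFunctions K).le_topologicalClosure ⟨p, by simp, rfl⟩
  let X : B := ⟨Polynomial.X.toContinuousMapOn K, hmem _⟩
  have hφp : ∀ p : Polynomial ℂ, φ ⟨p.toContinuousMapOn K, hmem p⟩ = p.eval (φ X) := by
    intro p
    have h1 : (⟨p.toContinuousMapOn K, hmem p⟩ : B) = Polynomial.aeval X p := by
      ext z
      have h2 := Polynomial.aeval_algHom_apply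
        ((ContinuousMap.evalAlgHom ℂ ℂ z).comp B.val) X p
      simp only [AlgHom.comp_apply, Subalgebra.val_apply, ContinuousMap.evalAlgHom_apply] at h2
      rw [← h2]
      simp [X]
    rw [h1, ← Polynomial.aeval_algHom_apply, Polynomial.coe_aeval_eq_eval]
  have hK : φ X ∈ K := by
    by_contra hK
    obtain ⟨G, hG, hGz⟩ := PolyApprox.sub_inv hc hK
    have h1 : (X - algebraMap ℂ B (φ X)) * ⟨G, hG⟩ = 1 := by
      ext z
      have : (z : ℂ) - φ X ≠ 0 := sub_ne_zero.2 fun h => hK (h ▸ z.2)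
      simp [X, hGz, this]
    have := congrArg φ h1
    simp [AlgHomClass.commutes] at this
  let ev : B → ℂ := fun G => (G : C(K, ℂ)) ⟨φ X, hK⟩
  have hev : (fun G : B => φ G) = ev := by
    have hd : DenseRange fun p : Polynomial ℂ => (⟨p.toContinuousMapOn K, hmem p⟩ : B) := by
      rw [Metric.denseRange_iff]
      intro G ε hε
      obtain ⟨H, ⟨p, -, rfl⟩, hp⟩ := Metric.mem_closure_iff.1
        (show (G : C(K, ℂ)) ∈ closure (polynomialFunctions K : Set C(K, ℂ)) from G.2) ε hε
      exact ⟨p, hp⟩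
    refine hd.equalizer (map_continuous φ) ?_ (funext fun p => ?_)
    · exact (continuous_eval_const _).comp continuous_subtype_val
    · simp [hφp, ev]
  have := congrFun hev ⟨F, hF⟩
  rw [hφ] at this
  exact h0 _ hK (this.trans (hFf _)).symm

/-- A number whose square has positive real part is dominated by its real part. -/
theorem abs_im_lt_of_re_sq_pos {h : ℂ} (h2 : 0 < (h ^ 2).re) (h1 : 0 < h.re) : |h.im| < h.re := by
  rw [pow_two, Complex.mul_re] at h2
  exact abs_lt_of_sq_lt_sq (by nlinarith) h1.le

theorem re_pos_of_norm_sub_one_lt {w : ℂ} (hw : ‖w - 1‖ < 1) : 0 < w.re := by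
  have := (abs_le.1 (Complex.abs_re_le_norm (w - 1))).1
  simp at this
  linarith

/-- The principal square root of `1 + x`. -/
noncomputable def sqrtOneAdd (x : ℂ) : ℂ := (1 + x) ^ (1 / 2 : ℂ)

theorem sqrtOneAdd_sq (x : ℂ) : sqrtOneAdd x ^ 2 = 1 + x := by
  rw [sqrtOneAdd, ← Complex.cpow_nat_mul]
  simp

theorem differentiableOn_sqrtOneAdd : DifferentiableOn ℂ sqrtOneAdd (Metric.ball 0 1) := by
  intro x hx
  refine DifferentiableAt.differentiableWithinAt ?_
  refine DifferentiableAt.cpow (by fun_prop) (by fun_prop) (Or.inl ?_)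
  exact re_pos_of_norm_sub_one_lt (by simpa using hx)

theorem re_sqrtOneAdd_pos {x : ℂ} (hx : ‖x‖ < 1) : 0 < (sqrtOneAdd x).re := by
  have h1 : 0 < (1 + x).re := re_pos_of_norm_sub_one_lt (by simpa using hx)
  have h0 : 1 + x ≠ 0 := fun h => by simp [h] at h1
  rw [sqrtOneAdd, Complex.cpow_def_of_ne_zero h0, Complex.exp_re]
  refine mul_pos (Real.exp_pos _) (Real.cos_pos_of_mem_Ioo ?_)
  have h2 := Complex.abs_arg_lt_pi_div_two_iff.2 (Or.inl h1)
  rw [abs_lt] at h2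
  have h3 : (Complex.log (1 + x) * (1 / 2)).im = Complex.arg (1 + x) / 2 := by
    simp [Complex.mul_im, Complex.log_im]
    ring
  rw [h3]
  constructor <;> linarith [Real.pi_pos]

/-- There is a polynomially approximable branch `h` of the square root of `(z - c) / (z - b)`
on `K`, close to the principal one away from the disc of centre `c` and radius `r`. -/
def HasSqrtBranch (K : Set ℂ) [CompactSpace K] (c : ℂ) (r : ℝ) (b : ℂ) : Prop :=
  ‖b - c‖ < r ∧ b ∉ K ∧ ∃ h : ℂ → ℂ, PolyApprox K h ∧
    ∀ z ∈ K, h z ^ 2 = (z - c) / (z - b) ∧ (3 * r < ‖z - c‖ → 0 < (h z).re)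

theorem HasSqrtBranch.step {K : Set ℂ} [CompactSpace K] (hc : IsPreconnected Kᶜ) {c : ℂ} {r : ℝ}
    {b b' : ℂ} (hb : HasSqrtBranch K c r b) (hb' : ‖b' - c‖ < r) (hbK : b' ∉ K)
    (hd : ∀ z ∈ K, ‖b' - b‖ ≤ ‖z - b'‖ / 2) : HasSqrtBranch K c r b' := by
  obtain ⟨hbc, hbK', h, hh, hz⟩ := hb
  have hx : ∀ z ∈ K, ‖(b' - b) * (z - b')⁻¹‖ ≤ 1 / 2 := fun z hz => by
    have hzp : 0 < ‖z - b'‖ := norm_pos_iff.2 (sub_ne_zero.2 fun h => hbK (h ▸ hz))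
    rw [norm_mul, norm_inv, ← div_eq_mul_inv, div_le_iff₀ hzp]
    linarith [hd z hz]
  refine ⟨hb', hbK, fun z => h z * sqrtOneAdd ((b' - b) * (z - b')⁻¹), hh.mul
    (((PolyApprox.const _).mul (PolyApprox.sub_inv hc hbK)).comp_of_differentiableOn (by norm_num)
      differentiableOn_sqrtOneAdd hx), fun z hzK => ?_⟩
  have hzb : z - b ≠ 0 := sub_ne_zero.2 fun h => hbK' (h ▸ hzK)
  have hzb' : z - b' ≠ 0 := sub_ne_zero.2 fun h => hbK (h ▸ hzK)
  obtain ⟨h1, h2⟩ := hz z hzK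
  constructor
  · rw [mul_pow, h1, sqrtOneAdd_sq]
    field_simp
    ring
  · intro hfar
    have hx1 : ‖(b' - b) * (z - b')⁻¹‖ < 1 := (hx z hzK).trans_lt (by norm_num)
    have h3 := re_sqrtOneAdd_pos hx1
    have h4 : |(sqrtOneAdd ((b' - b) * (z - b')⁻¹)).im| < _ := abs_im_lt_of_re_sq_pos
      (by rw [sqrtOneAdd_sq]; exact re_pos_of_norm_sub_one_lt (by simpa using hx1)) h3
    have h5 : |(h z).im| < _ := abs_im_lt_of_re_sq_pos (by
      rw [h1]
      refine re_pos_of_norm_sub_one_lt ?_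
      have : (z - c) / (z - b) - 1 = (b - c) / (z - b) := by field_simp; ring
      rw [this, norm_div, div_lt_one (norm_pos_iff.2 hzb)]
      have : ‖z - c‖ ≤ ‖z - b‖ + ‖b - c‖ := norm_sub_le_norm_sub_add_norm_sub ..
      linarith [norm_nonneg (b - c)]) (h2 hfar)
    rw [Complex.mul_re, sub_pos]
    calc _ ≤ |(h z).im * (sqrtOneAdd ((b' - b) * (z - b')⁻¹)).im| := le_abs_self _
      _ = |(h z).im| * |(sqrtOneAdd ((b' - b) * (z - b')⁻¹)).im| := abs_mul _ _
      _ < _ := mul_lt_mul'' h5 h4 (abs_nonneg _) (abs_nonneg _)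

theorem exists_hasSqrtBranch {K : Set ℂ} [CompactSpace K] (hc : IsPreconnected Kᶜ) {c : ℂ}
    (hcK : c ∉ K) {r : ℝ} (hr : 0 < r) : ∃ b, HasSqrtBranch K c r b ∧ r / 2 ≤ ‖b - c‖ := by
  have hKc : IsClosed K := (isCompact_iff_compactSpace.2 ‹_›).isClosed
  by_contra! hcon
  have hall : ∀ x ∈ Kᶜ, HasSqrtBranch K c r x := by
    refine forall_of_isPreconnected hc ?_ hcK ⟨by simpa using hr, hcK, fun _ => 1, .const 1,
      fun z hz => ⟨?_, by simp⟩⟩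
    · intro x hx
      obtain ⟨η, hη, hball⟩ := Metric.isOpen_iff.1 hKc.isOpen_compl x hx
      have hfar : ∀ z ∈ K, η ≤ ‖z - x‖ := fun z hz => by
        by_contra! hlt
        exact hball (by simpa [dist_eq_norm] using hlt) hz
      rcases lt_or_ge ‖x - c‖ r with hxr | hxr
      · have hmem : ∀ᶠ y in nhds x, ‖y - c‖ < r :=
          (by fun_prop : Continuous fun y : ℂ => ‖y - c‖).continuousAt.eventually_lt
            continuousAt_const hxr
        filter_upwards [mem_nhdsWithin_of_mem_nhds (Metric.ball_mem_nhds x (by positivity :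
          0 < η / 3)), self_mem_nhdsWithin, mem_nhdsWithin_of_mem_nhds hmem] with y hy hyK hyr
        have hyx : ‖y - x‖ < η / 3 := by simpa [dist_eq_norm] using hy
        constructor
        · intro h
          refine h.step hc hyr hyK fun z hz => ?_
          have : ‖z - x‖ ≤ ‖z - y‖ + ‖y - x‖ := norm_sub_le_norm_sub_add_norm_sub ..
          linarith [hfar z hz]
        · intro h
          refine h.step hc hxr hx fun z hz => ?_
          rw [norm_sub_rev]
          linarith [hfar z hz]
      · have hmem : ∀ᶠ y in nhds x, r / 2 < ‖y - c‖ :=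
          continuousAt_const.eventually_lt
            (by fun_prop : Continuous fun y : ℂ => ‖y - c‖).continuousAt (by linarith)
        filter_upwards [mem_nhdsWithin_of_mem_nhds hmem] with y hy
        exact ⟨fun h => absurd h.1 (not_lt.2 hxr), fun h => absurd (hcon y h) (not_lt.2 hy.le)⟩
    · have hzc : z - c ≠ 0 := sub_ne_zero.2 fun h => hcK (h ▸ hz)
      rw [div_self hzc, one_pow]
  obtain ⟨M, hM⟩ : ∃ M : ℝ, ∀ z ∈ K, ‖z‖ ≤ M :=
    (isCompact_iff_compactSpace.2 ‹_›).isBounded.exists_norm_le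
  have hn : ‖((|M| + 1 + ‖c‖ + r : ℝ) : ℂ)‖ = |M| + 1 + ‖c‖ + r := by
    rw [Complex.norm_real, Real.norm_of_nonneg (by positivity)]
  have h1 := (hall ((|M| + 1 + ‖c‖ + r : ℝ) : ℂ) fun h => by
    have := hM _ h
    rw [hn] at this
    linarith [le_abs_self M, norm_nonneg c]).1
  have h2 := norm_sub_norm_le ((|M| + 1 + ‖c‖ + r : ℝ) : ℂ) c
  rw [hn] at h2
  linarith [abs_nonneg M]

/-- The second order expansion of `4 (h - 1) / (h + 1)` at `h = 1` in terms of `h ^ 2 - 1`. -/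
theorem norm_mobius_sqrt_sub_le {h t : ℂ} (ht : h ^ 2 = 1 + t) (hre : 0 < h.re)
    (ht1 : ‖t‖ ≤ 1 / 2) : ‖4 * (h - 1) / (h + 1) - t + t ^ 2 / 2‖ ≤ 7 * ‖t‖ ^ 3 := by
  have hm : 1 ≤ ‖h + 1‖ := by
    have := (le_abs_self _).trans (Complex.abs_re_le_norm (h + 1))
    simp at this
    linarith
  have hm0 : h + 1 ≠ 0 := norm_pos_iff.1 (by linarith)
  have hts : t = (h - 1) * (h + 1) := by linear_combination -ht
  have hs : ‖h - 1‖ ≤ ‖t‖ := by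
    rw [hts, norm_mul]
    exact le_mul_of_one_le_right (norm_nonneg _) hm
  have hm2 : ‖h + 1‖ ≤ 5 / 2 := by
    have : ‖h + 1‖ ≤ ‖h - 1‖ + ‖(2 : ℂ)‖ :=
      (congrArg norm (by ring)).trans_le (norm_add_le (h - 1) 2)
    rw [Complex.norm_ofNat] at this
    linarith
  have hid : 4 * (h - 1) / (h + 1) - t + t ^ 2 / 2 =
      (h - 1) ^ 3 * ((h + 1) ^ 2 + 2 * (h + 1) + 2) / (2 * (h + 1)) := by
    rw [hts]
    field_simp
    ring
  rw [hid, norm_div, norm_mul, norm_pow, norm_mul, Complex.norm_ofNat,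
    div_le_iff₀ (by positivity)]
  have h3 : ‖(h + 1) ^ 2 + 2 * (h + 1) + 2‖ ≤ 14 := by
    refine (norm_add₃_le).trans ?_
    rw [norm_pow, norm_mul, Complex.norm_ofNat]
    nlinarith
  calc ‖h - 1‖ ^ 3 * ‖(h + 1) ^ 2 + 2 * (h + 1) + 2‖ ≤ ‖t‖ ^ 3 * 14 := by gcongr
    _ ≤ 7 * ‖t‖ ^ 3 * (2 * ‖h + 1‖) := by
      nlinarith [pow_nonneg (norm_nonneg t) 3]

/-- The kernel which controls the error of the approximation of `(z - ζ)⁻¹`. -/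
noncomputable def errorKernel (r : ℝ) (w : ℂ) : ℝ := r ^ 2 / (‖w‖ * (r ^ 2 + ‖w‖ ^ 2))

theorem norm_expansion_far {g z ζ b d : ℂ} {r : ℝ} (hr : 0 < r) (hd : ‖d‖ ≤ r)
    (hd0 : d ≠ 0) (hζ : ‖ζ - b‖ ≤ 2 * r) (hzb : 2 * r ≤ ‖z - b‖) (hzζ : 2 * r ≤ ‖z - ζ‖)
    (hg : ‖d * g - d * (z - b)⁻¹ + (d * (z - b)⁻¹) ^ 2 / 2‖ ≤ 7 * ‖d * (z - b)⁻¹‖ ^ 3) :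
    ‖g + (ζ - (b - d / 2)) * g ^ 2 - (z - ζ)⁻¹‖ ≤ 500 * errorKernel r (z - ζ) := by
  set v := (z - b)⁻¹ with hv
  have hzb0 : z - b ≠ 0 := norm_pos_iff.1 (by linarith)
  have hzζ0 : z - ζ ≠ 0 := norm_pos_iff.1 (by linarith)
  have hdpos : 0 < ‖d‖ := norm_pos_iff.2 hd0
  have hvpos : 0 < ‖v‖ := norm_pos_iff.2 (inv_ne_zero hzb0)
  have hrv : r * ‖v‖ ≤ 1 / 2 := by
    rw [hv, norm_inv, ← div_eq_mul_inv, div_le_iff₀ (by linarith)]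
    linarith
  have h1 : ‖g - v + d * v ^ 2 / 2‖ ≤ 7 * r ^ 2 * ‖v‖ ^ 3 := by
    have h2 : d * g - d * v + (d * v) ^ 2 / 2 = d * (g - v + d * v ^ 2 / 2) := by ring
    rw [h2, norm_mul, norm_mul] at hg
    have h3 : ‖d‖ * ‖g - v + d * v ^ 2 / 2‖ ≤ ‖d‖ * (7 * ‖d‖ ^ 2 * ‖v‖ ^ 3) := by
      linarith
    refine (le_of_mul_le_mul_left h3 hdpos).trans ?_
    gcongr
  have h2 : ‖g - v‖ ≤ 4 * r * ‖v‖ ^ 2 := by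
    have h3 : ‖g - v‖ ≤ ‖g - v + d * v ^ 2 / 2‖ + ‖d * v ^ 2 / 2‖ :=
      (congrArg norm (by ring)).trans_le (norm_sub_le (g - v + d * v ^ 2 / 2) (d * v ^ 2 / 2))
    have h4 : ‖d * v ^ 2 / 2‖ ≤ r * ‖v‖ ^ 2 / 2 := by
      rw [norm_div, norm_mul, norm_pow, Complex.norm_ofNat]
      gcongr
    have h5 : 7 * r ^ 2 * ‖v‖ ^ 3 = 7 * (r * ‖v‖ ^ 2) * (r * ‖v‖) := by ring
    have h6 : 0 ≤ r * ‖v‖ ^ 2 := by positivity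
    nlinarith
  have h3 : ‖g ^ 2 - v ^ 2‖ ≤ 16 * r * ‖v‖ ^ 3 := by
    have h4 : g ^ 2 - v ^ 2 = (g - v) * ((g - v) + 2 * v) := by ring
    have h5 : ‖(g - v) + 2 * v‖ ≤ 4 * ‖v‖ := by
      refine (norm_add_le _ _).trans ?_
      rw [norm_mul, Complex.norm_ofNat]
      nlinarith
    rw [h4, norm_mul]
    calc _ ≤ (4 * r * ‖v‖ ^ 2) * (4 * ‖v‖) := by gcongr
      _ = _ := by ring
  have h4 : (z - ζ)⁻¹ = v + (ζ - b) * v ^ 2 + (ζ - b) ^ 2 * v ^ 2 * (z - ζ)⁻¹ := by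
    rw [hv]
    field_simp
    ring
  have hvz : ‖v‖ ≤ 2 * ‖(z - ζ)⁻¹‖ := by
    have : ‖z - ζ‖ ≤ ‖z - b‖ + ‖b - ζ‖ := norm_sub_le_norm_sub_add_norm_sub ..
    rw [norm_sub_rev b] at this
    rw [hv, norm_inv, norm_inv, ← div_eq_mul_inv, le_div_iff₀ (by linarith),
      inv_mul_le_iff₀ (by linarith)]
    linarith
  set y := ‖(z - ζ)⁻¹‖ with hy
  have hy0 : 0 ≤ y := norm_nonneg _
  have h5 : g + (ζ - (b - d / 2)) * g ^ 2 - (z - ζ)⁻¹ = (g - v + d * v ^ 2 / 2) +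
      (ζ - b + d / 2) * (g ^ 2 - v ^ 2) - (ζ - b) ^ 2 * v ^ 2 * (z - ζ)⁻¹ := by
    linear_combination -h4
  have h6 : ‖ζ - b + d / 2‖ ≤ 5 / 2 * r := by
    refine (norm_add_le _ _).trans ?_
    rw [norm_div, Complex.norm_ofNat]
    linarith
  have h7 : ‖g + (ζ - (b - d / 2)) * g ^ 2 - (z - ζ)⁻¹‖ ≤ 400 * r ^ 2 * y ^ 3 := by
    rw [h5]
    refine (norm_sub_le _ _).trans ((add_le_add_left (norm_add_le _ _) _).trans ?_)
    rw [norm_mul, norm_mul, norm_mul, norm_pow, norm_pow]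
    calc _ ≤ 7 * r ^ 2 * (2 * y) ^ 3 + 5 / 2 * r * (16 * r * (2 * y) ^ 3) +
          (2 * r) ^ 2 * (2 * y) ^ 2 * y := by
          gcongr
          · exact h1.trans (by gcongr)
          · exact h3.trans (by gcongr)
      _ = 392 * (r ^ 2 * y ^ 3) := by ring
      _ ≤ 400 * r ^ 2 * y ^ 3 := by nlinarith [mul_nonneg (sq_nonneg r) (pow_nonneg hy0 3)]
  refine h7.trans ?_
  have hpos : 0 < ‖z - ζ‖ := norm_pos_iff.2 hzζ0
  rw [hy, norm_inv, errorKernel, inv_pow, ← div_eq_mul_inv, ← mul_div_assoc,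
    div_le_div_iff₀ (by positivity) (by positivity)]
  have h8 : 4 * r ^ 2 ≤ ‖z - ζ‖ ^ 2 := by nlinarith
  have h9 : 0 ≤ r ^ 2 * ‖z - ζ‖ := by positivity
  nlinarith

/-- A polynomially approximable substitute for the Cauchy kernel `ζ ↦ (z - ζ)⁻¹`, `z ∈ K`, for `ζ`
in a disc centred at a point outside of `K`. -/
theorem exists_cauchy_kernel_approx {K : Set ℂ} [CompactSpace K] (hc : IsPreconnected Kᶜ) {c : ℂ}
    (hcK : c ∉ K) {r : ℝ} (hr : 0 < r) : ∃ (g : ℂ → ℂ) (a : ℂ), PolyApprox K g ∧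
      ∀ z ∈ K, ∀ ζ, ‖ζ - c‖ ≤ r → z ≠ ζ →
        ‖g z + (ζ - a) * g z ^ 2 - (z - ζ)⁻¹‖ ≤ 10 ^ 8 * errorKernel r (z - ζ) := by
  obtain ⟨b, ⟨hbr, hbK, h, hh, hhz⟩, hbc⟩ := exists_hasSqrtBranch hc hcK hr
  set d := b - c with hd
  have hdpos : 0 < ‖d‖ := by linarith
  have hd0 : d ≠ 0 := norm_pos_iff.1 hdpos
  have hzb : ∀ z ∈ K, z - b ≠ 0 := fun z hz => sub_ne_zero.2 fun h => hbK (h ▸ hz)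
  have hsq : ∀ z ∈ K, h z ^ 2 = 1 + d * (z - b)⁻¹ := fun z hz => by
    rw [(hhz z hz).1, hd]
    have := hzb z hz
    field_simp
    ring
  have hlow : ∀ z ∈ K, 1 / 24 ≤ ‖h z + 1‖ := fun z hz => by
    rcases lt_or_ge (3 * r) ‖z - c‖ with hfar | hnear
    · have h1 := (le_abs_self _).trans (Complex.abs_re_le_norm (h z + 1))
      have h2 := (hhz z hz).2 hfar
      simp at h1
      linarith
    · by_contra! hlt
      have h1 : (h z + 1) * (h z - 1) = d * (z - b)⁻¹ := by linear_combination hsq z hz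
      have h2 : ‖h z + 1‖ * ‖h z - 1‖ = ‖d‖ * ‖z - b‖⁻¹ := by
        rw [← norm_inv, ← norm_mul, ← norm_mul, h1]
      have h3 : ‖z - b‖ ≤ ‖z - c‖ + ‖c - b‖ := norm_sub_le_norm_sub_add_norm_sub ..
      rw [norm_sub_rev c b] at h3
      have h4 : 1 / 8 ≤ ‖d‖ * ‖z - b‖⁻¹ := by
        rw [← div_eq_mul_inv, le_div_iff₀ (norm_pos_iff.2 (hzb z hz))]
        linarith
      have h5 : ‖h z - 1‖ ≤ ‖h z + 1‖ + ‖(2 : ℂ)‖ :=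
      (congrArg norm (by ring)).trans_le (norm_sub_le (h z + 1) 2)
      rw [Complex.norm_ofNat] at h5
      nlinarith [norm_nonneg (h z + 1), norm_nonneg (h z - 1)]
  have hne : ∀ z ∈ K, h z + 1 ≠ 0 := fun z hz =>
    norm_pos_iff.1 (by linarith [hlow z hz])
  refine ⟨fun z => 4 / d * (h z - 1) * (h z + 1)⁻¹, b - d / 2, ?_, fun z hz ζ hζ hzζ => ?_⟩
  · refine PolyApprox.mul (.mul (.const _) ?_) (.inv hc (hh.add (.const 1)) hne)
    simpa [sub_eq_add_neg] using hh.add (.const (-1))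
  beta_reduce
  generalize hg : 4 / d * (h z - 1) * (h z + 1)⁻¹ = g
  have hζb : ‖ζ - b‖ ≤ 2 * r := by
    have : ‖ζ - b‖ ≤ ‖ζ - c‖ + ‖c - b‖ := norm_sub_le_norm_sub_add_norm_sub ..
    rw [norm_sub_rev c b] at this
    linarith
  have hcζ : ‖z - c‖ ≤ ‖z - ζ‖ + ‖ζ - c‖ := norm_sub_le_norm_sub_add_norm_sub ..
  have hcζ' : ‖z - ζ‖ ≤ ‖z - c‖ + ‖c - ζ‖ := norm_sub_le_norm_sub_add_norm_sub ..
  rw [norm_sub_rev c ζ] at hcζ'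
  have hpos : 0 < ‖z - ζ‖ := norm_pos_iff.2 (sub_ne_zero.2 hzζ)
  have hker : 0 ≤ errorKernel r (z - ζ) := by unfold errorKernel; positivity
  rcases lt_or_ge (3 * r) ‖z - c‖ with hfar | hnear
  · have hb2 : 2 * r ≤ ‖z - b‖ := by
      have : ‖z - c‖ ≤ ‖z - b‖ + ‖b - c‖ := norm_sub_le_norm_sub_add_norm_sub ..
      linarith
    refine (norm_expansion_far hr hbr.le hd0 hζb hb2 (by linarith) ?_).trans (by linarith)
    have hdg : d * g = 4 * (h z - 1) / (h z + 1) := by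
      rw [← hg]; field_simp
    rw [hdg]
    refine norm_mobius_sqrt_sub_le (hsq z hz) ((hhz z hz).2 hfar) ?_
    rw [norm_mul, norm_inv, ← div_eq_mul_inv, div_le_iff₀ (by linarith)]
    linarith
  · have hgn : ‖g‖ * r ≤ 400 := by
      have h1 : g = 4 / d * (1 - 2 * (h z + 1)⁻¹) := by
        rw [← hg]
        have := hne z hz
        field_simp
        ring
      have h2 : ‖1 - 2 * (h z + 1)⁻¹‖ ≤ 49 := by
        refine (norm_sub_le _ _).trans ?_
        rw [norm_mul, norm_inv, norm_one, Complex.norm_ofNat]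
        have : ‖h z + 1‖⁻¹ ≤ 24 := by
          rw [inv_le_comm₀ (norm_pos_iff.2 (hne z hz)) (by norm_num)]
          linarith [hlow z hz]
        linarith
      rw [h1, norm_mul, norm_div, Complex.norm_ofNat]
      have h3 : 4 / ‖d‖ * r ≤ 8 := by
        rw [div_mul_eq_mul_div, div_le_iff₀ hdpos]
        linarith
      have h4 : 0 ≤ 4 / ‖d‖ * r := by positivity
      nlinarith [norm_nonneg (1 - 2 * (h z + 1)⁻¹)]
    have h4 : ‖ζ - (b - d / 2)‖ ≤ 5 / 2 * r := by
      have : ζ - (b - d / 2) = (ζ - b) + d / 2 := by ring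
      rw [this]
      refine (norm_add_le _ _).trans ?_
      rw [norm_div, Complex.norm_ofNat]
      linarith
    have h5 : ‖g + (ζ - (b - d / 2)) * g ^ 2 - (z - ζ)⁻¹‖ * ‖z - ζ‖ ≤ 2000000 := by
      have h6 : ‖g + (ζ - (b - d / 2)) * g ^ 2 - (z - ζ)⁻¹‖ ≤
          ‖g‖ + 5 / 2 * r * ‖g‖ ^ 2 + ‖z - ζ‖⁻¹ := by
        refine (norm_sub_le _ _).trans ?_
        rw [norm_inv]
        gcongr
        refine (norm_add_le _ _).trans ?_
        rw [norm_mul, norm_pow]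
        gcongr
      calc _ ≤ (‖g‖ + 5 / 2 * r * ‖g‖ ^ 2 + ‖z - ζ‖⁻¹) * ‖z - ζ‖ := by gcongr
        _ = (‖g‖ + 5 / 2 * r * ‖g‖ ^ 2) * ‖z - ζ‖ + 1 := by
          rw [add_mul, inv_mul_cancel₀ hpos.ne']
        _ ≤ (‖g‖ + 5 / 2 * r * ‖g‖ ^ 2) * (4 * r) + 1 := by
          gcongr
          linarith
        _ = 4 * (‖g‖ * r) + 10 * (‖g‖ * r) ^ 2 + 1 := by ring
        _ ≤ 4 * 400 + 10 * 400 ^ 2 + 1 := by gcongr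
        _ ≤ 2000000 := by norm_num
    rw [← le_div_iff₀ hpos] at h5
    refine h5.trans ?_
    rw [errorKernel, ← mul_div_assoc, div_le_div_iff₀ hpos (by positivity)]
    have h6 : ‖z - ζ‖ ^ 2 ≤ 16 * r ^ 2 := by nlinarith
    nlinarith

section Polar

open MeasureTheory

theorem Complex.integrableOn_comp_polarCoord_symm {f : ℂ → ℂ} (hf : Integrable f) :
    IntegrableOn (fun p => p.1 • f (Complex.polarCoord.symm p)) polarCoord.target := by
  have h1 : Integrable (f ∘ measurableEquivRealProd.symm) :=
    (Complex.volume_preserving_equiv_real_prod.symm).integrable_comp_of_integrable hf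
  have h2 := (integrableOn_image_iff_integrableOn_abs_det_fderiv_smul volume
    polarCoord.open_target.measurableSet
    (fun p _ => (hasFDerivAt_polarCoord_symm p).hasFDerivWithinAt) polarCoord.symm.injOn
    (f ∘ measurableEquivRealProd.symm)).1 h1.integrableOn
  refine h2.congr_fun (fun p hp => ?_) polarCoord.open_target.measurableSet
  simp only [det_fderivPolarCoordSymm]
  rw [abs_of_pos hp.1]
  rfl

theorem Complex.integral_eq_integral_circleMap {f : ℂ → ℂ} (hf : Integrable f) :
    ∫ z, f z = ∫ ρ in Ioi (0 : ℝ), ρ • ∫ θ in (0)..(2 * Real.pi), f (circleMap 0 ρ θ) := by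
  have hint := Complex.integrableOn_comp_polarCoord_symm hf
  rw [← Complex.integral_comp_polarCoord_symm, polarCoord_target, Measure.volume_eq_prod,
    setIntegral_prod _ (by
      rwa [polarCoord_target, Measure.volume_eq_prod] at hint)]
  refine setIntegral_congr_fun measurableSet_Ioi fun ρ _ => ?_
  have hper : Function.Periodic (fun θ => f (circleMap 0 ρ θ)) (2 * Real.pi) := fun θ => by
    simp only [periodic_circleMap 0 ρ θ]
  have h1 := hper.intervalIntegral_add_eq (-Real.pi) 0
  rw [show -Real.pi + 2 * Real.pi = Real.pi by ring, zero_add] at h1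
  simp only [integral_smul]
  rw [← h1, intervalIntegral.integral_of_le (by linarith [Real.pi_pos]),
    integral_Ioc_eq_integral_Ioo]
  simp [circleMap, Complex.exp_mul_I]

theorem Complex.setIntegral_ball_mul {F : ℂ → ℂ} {δ : ℝ}
    (hF : IntegrableOn (fun w => w * F w) (Metric.ball 0 δ)) :
    ∫ w in Metric.ball 0 δ, w * F w =
      ∫ ρ in Ioo 0 δ, ρ • (-I * ∮ w in C(0, ρ), F w) := by
  rw [← integral_indicator measurableSet_ball, Complex.integral_eq_integral_circleMap
    ((integrable_indicator_iff measurableSet_ball).2 hF), ← Ioi_inter_Iio,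
    ← setIntegral_indicator measurableSet_Iio]
  refine setIntegral_congr_fun measurableSet_Ioi fun ρ hρ => ?_
  have hρ' : (0 : ℝ) < ρ := hρ
  by_cases h : ρ < δ
  · have hmem : ∀ θ, circleMap 0 ρ θ ∈ Metric.ball (0 : ℂ) δ := fun θ => by
      simp [abs_of_pos hρ', h]
    simp only [indicator_of_mem (hmem _), circleIntegral, deriv_circleMap, smul_eq_mul]
    rw [indicator_of_mem (by exact h), ← intervalIntegral.integral_const_mul]
    congr 2
    ext θ
    linear_combination (circleMap 0 ρ θ * F (circleMap 0 ρ θ)) * I_mul_I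
  · have hmem : ∀ θ, circleMap 0 ρ θ ∉ Metric.ball (0 : ℂ) δ := fun θ => by
      simpa [abs_of_pos hρ'] using h
    simp only [indicator_of_notMem (hmem _)]
    rw [indicator_of_notMem (by exact h)]
    simp

theorem integrable_errorKernel {r : ℝ} (hr : 0 < r) : Integrable (errorKernel r) ∧
    ∫ w, errorKernel r w = Real.pi ^ 2 * r := by
  have hcongr : EqOn (fun y : ℝ => r⁻¹ ^ 0 • (1 + (r⁻¹ * y) ^ 2)⁻¹)
      (fun y : ℝ => y ^ (Module.finrank ℝ ℂ - 1) • (r ^ 2 / (y * (r ^ 2 + y ^ 2)))) (Ioi 0) := by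
    intro y hy
    have hy' : (0 : ℝ) < y := hy
    simp [Complex.finrank_real_complex]
    field_simp
  have h1 : Integrable (fun y : ℝ => r⁻¹ ^ 0 • (1 + (r⁻¹ * y) ^ 2)⁻¹) := by
    simpa using! integrable_inv_one_add_sq.comp_mul_left' (inv_ne_zero hr.ne')
  constructor
  · refine (integrable_fun_norm_addHaar volume
      (f := fun y : ℝ => r ^ 2 / (y * (r ^ 2 + y ^ 2)))).2 ?_
    exact h1.integrableOn.congr_fun hcongr measurableSet_Ioi
  · have h2 := integral_fun_norm_addHaar (volume : Measure ℂ)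
      (fun y : ℝ => r ^ 2 / (y * (r ^ 2 + y ^ 2)))
    rw [← setIntegral_congr_fun measurableSet_Ioi hcongr] at h2
    refine h2.trans ?_
    have h3 := integral_comp_mul_left_Ioi (fun y : ℝ => (1 + y ^ 2)⁻¹) 0 (inv_pos.2 hr)
    simp only [mul_zero, integral_Ioi_inv_one_add_sq] at h3
    simp [Complex.finrank_real_complex, measureReal_def, h3]
    ring

theorem locallyIntegrable_inv : LocallyIntegrable (fun w : ℂ => w⁻¹) := by
  rw [locallyIntegrable_iff]
  intro S hS
  obtain ⟨M, hM⟩ := hS.isBounded.exists_norm_le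
  refine Integrable.mono' (((integrable_errorKernel one_pos).1.const_mul (1 + M ^ 2)).integrableOn)
    (by fun_prop) ?_
  filter_upwards [ae_restrict_mem hS.measurableSet] with w hw
  have h1 := hM w hw
  rcases eq_or_ne w 0 with rfl | h0
  · simp [errorKernel]
  have h2 : 0 < ‖w‖ := norm_pos_iff.2 h0
  rw [errorKernel, norm_inv, mul_div_assoc', inv_eq_one_div, div_le_div_iff₀ h2 (by positivity)]
  have : ‖w‖ ^ 2 ≤ M ^ 2 := by gcongr
  nlinarith

theorem integrableOn_sub_inv (z : ℂ) {S : Set ℂ} (hS : IsCompact S) :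
    IntegrableOn (fun ζ => (z - ζ)⁻¹) S := by
  have h1 : IntegrableOn (fun w : ℂ => w⁻¹) ((fun ζ => z - ζ) '' S) :=
    locallyIntegrable_inv.integrableOn_isCompact (hS.image (by fun_prop))
  exact ((Measure.measurePreserving_sub_left volume z).integrableOn_image
    (Homeomorph.subLeft z).measurableEmbedding).1 h1

theorem setIntegral_ball_mul_sub_inv (z : ℂ) {δ : ℝ} (hδ : 0 < δ) :
    ∫ w in Metric.ball 0 δ, w * (z - w)⁻¹ = ((-Real.pi * max (δ ^ 2 - ‖z‖ ^ 2) 0 : ℝ) : ℂ) := by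
  have hint : IntegrableOn (fun w : ℂ => w * (z - w)⁻¹) (Metric.ball 0 δ) :=
    (IntegrableOn.continuousOn_mul continuousOn_id
      (integrableOn_sub_inv z (isCompact_closedBall 0 δ)) (isCompact_closedBall 0 δ)).mono_set
      Metric.ball_subset_closedBall
  rw [Complex.setIntegral_ball_mul hint]
  have hcirc : ∀ ρ : ℝ, 0 < ρ → ρ ≠ ‖z‖ → ∮ w in C(0, ρ), (z - w)⁻¹ =
      if ‖z‖ < ρ then -(2 * Real.pi * I) else 0 := by
    intro ρ hρ hne
    have hneg : (fun w : ℂ => (z - w)⁻¹) = fun w => (-1) * (w - z)⁻¹ := by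
      ext w; rw [neg_one_mul, ← inv_neg, neg_sub]
    split_ifs with h
    · rw [hneg, circleIntegral.integral_const_mul,
        circleIntegral.integral_sub_inv_of_mem_ball (by simpa), neg_one_mul]
    · have hlt : ρ < ‖z‖ := lt_of_le_of_ne (not_lt.1 h) hne
      have hd : ∀ w ∈ Metric.closedBall (0 : ℂ) ρ, DifferentiableAt ℂ (fun w => (z - w)⁻¹) w := by
        intro w hw
        refine DifferentiableAt.inv (by fun_prop) (sub_ne_zero.2 ?_)
        rintro rfl
        simp at hw
        linarith
      exact circleIntegral_eq_zero_of_differentiable_on_off_countable hρ.le countable_empty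
        (fun w hw => (hd w hw).continuousAt.continuousWithinAt)
        (fun w hw => hd w (Metric.ball_subset_closedBall hw.1))
  have h1 : ∫ ρ in Ioo 0 δ, ρ • (-I * ∮ w in C(0, ρ), (z - w)⁻¹) =
      ∫ ρ in Ioo 0 δ, (Ioi ‖z‖).indicator (fun ρ : ℝ => ((-2 * Real.pi * ρ : ℝ) : ℂ)) ρ := by
    refine setIntegral_congr_ae measurableSet_Ioo ?_
    filter_upwards [Measure.ae_ne volume ‖z‖] with ρ hne hρ
    rw [hcirc ρ hρ.1 hne]
    split_ifs with h
    · rw [indicator_of_mem (by exact h)]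
      simp only [real_smul]
      push_cast
      linear_combination (2 * Real.pi * ρ : ℂ) * I_mul_I
    · rw [indicator_of_notMem (by exact h)]
      simp
  rw [h1, setIntegral_indicator measurableSet_Ioi, integral_complex_ofReal]
  congr 1
  have h2 : Ioo 0 δ ∩ Ioi ‖z‖ = Ioo ‖z‖ δ := by
    ext x; simp only [mem_inter_iff, mem_Ioo, mem_Ioi]
    constructor
    · rintro ⟨⟨_, h⟩, h'⟩; exact ⟨h', h⟩
    · rintro ⟨h, h'⟩; exact ⟨⟨(norm_nonneg z).trans_lt h, h'⟩, h⟩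
  rw [h2]
  rcases le_or_gt δ ‖z‖ with h | h
  · rw [Ioo_eq_empty (not_lt.2 h), max_eq_right (by nlinarith [norm_nonneg z])]
    simp
  · rw [max_eq_left (by nlinarith [norm_nonneg z]), ← integral_Ioc_eq_integral_Ioo,
      ← intervalIntegral.integral_of_le h.le, intervalIntegral.integral_const_mul, integral_id]
    ring

theorem integral_max_sub_sq {δ : ℝ} (hδ : 0 < δ) :
    ∫ w : ℂ, max (δ ^ 2 - ‖w‖ ^ 2) 0 = Real.pi * δ ^ 4 / 2 := by
  have h2 := integral_fun_norm_addHaar (volume : Measure ℂ) (fun y : ℝ => max (δ ^ 2 - y ^ 2) 0)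
  refine h2.trans ?_
  have h3 : ∫ y in Ioi (0 : ℝ), y ^ (Module.finrank ℝ ℂ - 1) • max (δ ^ 2 - y ^ 2) 0 =
      ∫ y in (0)..δ, (δ ^ 2 * y - y ^ 3) := by
    rw [intervalIntegral.integral_of_le hδ.le, integral_Ioc_eq_integral_Ioo, ← Ioi_inter_Iio,
      ← setIntegral_indicator measurableSet_Iio]
    refine setIntegral_congr_fun measurableSet_Ioi fun y hy => ?_
    have hy' : (0 : ℝ) < y := hy
    by_cases h : y < δ
    · rw [indicator_of_mem (by exact h), max_eq_left (by nlinarith)]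
      simp [Complex.finrank_real_complex]
      ring
    · rw [indicator_of_notMem (by exact h), max_eq_right (by nlinarith [not_lt.1 h])]
      simp
  rw [h3, intervalIntegral.integral_sub
    (Continuous.intervalIntegrable (by fun_prop) _ _)
    (Continuous.intervalIntegrable (by fun_prop) _ _),
    intervalIntegral.integral_const_mul, integral_id, integral_pow]
  simp [Complex.finrank_real_complex, measureReal_def]
  ring

end Polar

section BallMoment

open MeasureTheory

/-- The first moment `∫ w, |w| < δ, w F(ζ - w)`, which vanishes where `F` is holomorphic on the
ball of radius `δ` around `ζ`. -/
noncomputable def ballMoment (F : ℂ → ℂ) (δ : ℝ) (ζ : ℂ) : ℂ :=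
  ∫ w in Metric.ball 0 δ, w * F (ζ - w)

variable {F : ℂ → ℂ} {δ : ℝ}

theorem Complex.integrableOn_ball_of_continuousOn {G : ℂ → ℂ}
    (hG : ContinuousOn G (Metric.closedBall 0 δ)) : IntegrableOn G (Metric.ball 0 δ) :=
  (hG.integrableOn_compact (isCompact_closedBall 0 δ)).mono_set Metric.ball_subset_closedBall

theorem stronglyMeasurable_ballMoment (hF : Continuous F) (δ : ℝ) :
    StronglyMeasurable (ballMoment F δ) := by
  have h : Continuous (fun p : ℂ × ℂ => p.2 * F (p.1 - p.2)) := by fun_prop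
  exact h.stronglyMeasurable.integral_prod_right'
    (ν := volume.restrict (Metric.ball (0 : ℂ) δ))

theorem setIntegral_ball_id (δ : ℝ) : ∫ w in Metric.ball (0 : ℂ) δ, w = 0 := by
  have h := Complex.setIntegral_ball_mul (F := fun _ => 1) (δ := δ)
    (Complex.integrableOn_ball_of_continuousOn (by fun_prop))
  simp only [mul_one] at h
  rw [h]
  refine setIntegral_eq_zero_of_forall_eq_zero fun ρ hρ => ?_
  have : ∮ w in C((0 : ℂ), ρ), (1 : ℂ) = 0 :=
    circleIntegral_eq_zero_of_differentiable_on_off_countable hρ.1.le countable_empty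
      (by fun_prop) (fun z _ => by fun_prop)
  simp [this]

theorem norm_ballMoment_le (hF : Continuous F) (hδ : 0 < δ) {ε : ℝ} {ζ : ℂ}
    (h : ∀ u, ‖ζ - u‖ < δ → ‖F u - F ζ‖ ≤ ε) :
    ‖ballMoment F δ ζ‖ ≤ Real.pi * ε * δ ^ 3 := by
  have h0 : ballMoment F δ ζ = ∫ w in Metric.ball 0 δ, w * (F (ζ - w) - F ζ) := by
    simp only [mul_sub]
    rw [integral_sub (Complex.integrableOn_ball_of_continuousOn (by fun_prop))
      (Complex.integrableOn_ball_of_continuousOn (by fun_prop)), integral_mul_const,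
      setIntegral_ball_id, zero_mul, sub_zero, ballMoment]
  have h1 : ∀ w ∈ Metric.ball (0 : ℂ) δ, ‖w * (F (ζ - w) - F ζ)‖ ≤ δ * ε := by
    intro w hw
    rw [mem_ball_zero_iff] at hw
    rw [norm_mul]
    gcongr
    exact h _ (by simpa using hw)
  rw [h0]
  refine (norm_setIntegral_le_of_norm_le_const measure_ball_lt_top h1).trans (le_of_eq ?_)
  rw [Measure.real, Complex.volume_ball]
  simp [hδ.le]
  ring

theorem ballMoment_eq_zero (hF : Continuous F) {ζ : ℂ}
    (h : DifferentiableOn ℂ F (Metric.ball ζ δ)) : ballMoment F δ ζ = 0 := by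
  rw [ballMoment, Complex.setIntegral_ball_mul
    (Complex.integrableOn_ball_of_continuousOn (by fun_prop))]
  refine setIntegral_eq_zero_of_forall_eq_zero fun ρ hρ => ?_
  have : ∮ w in C((0 : ℂ), ρ), F (ζ - w) = 0 := by
    refine circleIntegral_eq_zero_of_differentiable_on_off_countable hρ.1.le countable_empty
      (by fun_prop) fun w hw => ?_
    have hw' : ζ - w ∈ Metric.ball ζ δ := by
      have := hw.1
      rw [mem_ball_zero_iff] at this
      simpa using this.trans hρ.2
    exact (h.differentiableAt (Metric.isOpen_ball.mem_nhds hw')).comp w (by fun_prop)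
  simp [this]

theorem ballMoment_eq_zero_of_lt {R : ℝ} (hR : ∀ u, R < ‖u‖ → F u = 0) {ζ : ℂ}
    (hζ : R + δ < ‖ζ‖) : ballMoment F δ ζ = 0 := by
  refine setIntegral_eq_zero_of_forall_eq_zero fun w hw => ?_
  rw [mem_ball_zero_iff] at hw
  rw [hR _ (by linarith [norm_sub_norm_le ζ w]), mul_zero]

theorem ballMoment_eq_integral (F : ℂ → ℂ) (δ : ℝ) (ζ : ℂ) :
    ballMoment F δ ζ = ∫ u, F u * (Metric.ball 0 δ).indicator (fun w => w) (ζ - u) := by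
  rw [ballMoment, ← integral_indicator measurableSet_ball,
    ← integral_sub_left_eq_self _ volume ζ]
  refine integral_congr_ae (.of_forall fun u => ?_)
  by_cases hu : ζ - u ∈ Metric.ball (0 : ℂ) δ
  · simp only [indicator_of_mem hu]
    rw [sub_sub_cancel, mul_comm]
  · simp only [indicator_of_notMem hu]
    simp

theorem integral_ballMoment_mul_sub_inv (hF : Continuous F) (hδ : 0 < δ) {R : ℝ}
    (hR : ∀ u, R < ‖u‖ → F u = 0) (z : ℂ) :
    ∫ ζ, ballMoment F δ ζ * (z - ζ)⁻¹ =
      -Real.pi * ∫ u, F u * (max (δ ^ 2 - ‖z - u‖ ^ 2) 0 : ℝ) := by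
  have hFi : Integrable F := by
    refine hF.integrable_of_hasCompactSupport (.intro (isCompact_closedBall 0 R) fun u hu => ?_)
    exact hR u (by simpa using hu)
  have hk : Integrable ((Metric.closedBall 0 (R + δ)).indicator fun ζ => (z - ζ)⁻¹) :=
    (integrable_indicator_iff measurableSet_closedBall).2
      (integrableOn_sub_inv z (isCompact_closedBall 0 (R + δ)))
  have hb : Measurable ((Metric.ball (0 : ℂ) δ).indicator fun w => w) :=
    measurable_id.indicator measurableSet_ball
  have hint : Integrable (fun p : ℂ × ℂ =>
      F p.2 * (Metric.ball 0 δ).indicator (fun w => w) (p.1 - p.2) * (z - p.1)⁻¹)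
      (volume.prod volume) := by
    refine ((hk.norm.mul_prod hFi.norm).const_mul δ).mono' ?_ (.of_forall fun p => ?_)
    · refine Measurable.aestronglyMeasurable ?_
      have := hF.measurable
      fun_prop
    · by_cases h1 : p.1 - p.2 ∈ Metric.ball (0 : ℂ) δ
      · by_cases h2 : R < ‖p.2‖
        · simp [hR _ h2]
        · have h3 : p.1 ∈ Metric.closedBall (0 : ℂ) (R + δ) := by
            rw [mem_ball_zero_iff] at h1
            rw [mem_closedBall_zero_iff]
            linarith [norm_sub_norm_le p.1 p.2]
          simp only [indicator_of_mem h1, indicator_of_mem h3, norm_mul]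
          rw [mem_ball_zero_iff] at h1
          calc ‖F p.2‖ * ‖p.1 - p.2‖ * ‖(z - p.1)⁻¹‖
              ≤ ‖F p.2‖ * δ * ‖(z - p.1)⁻¹‖ := by gcongr
            _ = _ := by ring
      · simp only [indicator_of_notMem h1, mul_zero, zero_mul, norm_zero]
        positivity
  calc ∫ ζ, ballMoment F δ ζ * (z - ζ)⁻¹
      = ∫ ζ, ∫ u, F u * (Metric.ball 0 δ).indicator (fun w => w) (ζ - u) * (z - ζ)⁻¹ := by
        simp_rw [ballMoment_eq_integral, integral_mul_const]
    _ = ∫ u, ∫ ζ, F u * (Metric.ball 0 δ).indicator (fun w => w) (ζ - u) * (z - ζ)⁻¹ :=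
        integral_integral_swap hint
    _ = ∫ u, -Real.pi * (F u * (max (δ ^ 2 - ‖z - u‖ ^ 2) 0 : ℝ)) := by
        refine integral_congr_ae (.of_forall fun u => ?_)
        have h1 := setIntegral_ball_mul_sub_inv (z - u) hδ
        rw [← integral_indicator measurableSet_ball, ← integral_sub_right_eq_self _ u] at h1
        have h2 : ∀ ζ, (Metric.ball (0 : ℂ) δ).indicator (fun w => w * (z - u - w)⁻¹) (ζ - u) =
            (Metric.ball 0 δ).indicator (fun w => w) (ζ - u) * (z - ζ)⁻¹ := by
          intro ζ
          by_cases h : ζ - u ∈ Metric.ball (0 : ℂ) δ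
          · simp only [indicator_of_mem h, sub_sub_sub_cancel_right]
          · simp only [indicator_of_notMem h, zero_mul]
        simp only [h2] at h1
        simp only [mul_assoc]
        rw [integral_const_mul, h1]
        push_cast
        ring
    _ = _ := integral_const_mul _ _

theorem norm_integral_mul_max_sub_le (hF : Continuous F) (hδ : 0 < δ) {R : ℝ}
    (hR : ∀ u, R < ‖u‖ → F u = 0) {ε : ℝ} {z : ℂ}
    (h : ∀ u, ‖z - u‖ < δ → ‖F u - F z‖ ≤ ε) :
    ‖(∫ u, F u * (max (δ ^ 2 - ‖z - u‖ ^ 2) 0 : ℝ)) - F z * (Real.pi * δ ^ 4 / 2 : ℝ)‖ ≤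
      ε * (Real.pi * δ ^ 4 / 2) := by
  have hcont : Continuous fun u : ℂ => max (δ ^ 2 - ‖z - u‖ ^ 2) 0 := by fun_prop
  have hzero : ∀ u, δ ≤ ‖z - u‖ → max (δ ^ 2 - ‖z - u‖ ^ 2) 0 = 0 := fun u hu =>
    max_eq_right (by nlinarith)
  have hcs : HasCompactSupport fun u : ℂ => max (δ ^ 2 - ‖z - u‖ ^ 2) 0 := by
    refine .intro (isCompact_closedBall z δ) fun u hu => hzero u ?_
    rw [Metric.mem_closedBall, dist_comm, dist_eq_norm] at hu
    linarith
  have hki : Integrable fun u : ℂ => max (δ ^ 2 - ‖z - u‖ ^ 2) 0 :=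
    hcont.integrable_of_hasCompactSupport hcs
  have hkint : ∫ u : ℂ, max (δ ^ 2 - ‖z - u‖ ^ 2) 0 = Real.pi * δ ^ 4 / 2 := by
    rw [← integral_max_sub_sq hδ]
    exact integral_sub_left_eq_self (fun w : ℂ => max (δ ^ 2 - ‖w‖ ^ 2) 0) volume z
  have hFk : Integrable fun u => F u * (max (δ ^ 2 - ‖z - u‖ ^ 2) 0 : ℝ) := by
    refine Continuous.integrable_of_hasCompactSupport (by fun_prop) ?_
    refine .intro (isCompact_closedBall 0 R) fun u hu => ?_
    rw [hR u (by simpa using hu), zero_mul]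
  have hzk : Integrable fun u => F z * ((max (δ ^ 2 - ‖z - u‖ ^ 2) 0 : ℝ) : ℂ) :=
    hki.ofReal.const_mul _
  rw [← hkint, ← integral_complex_ofReal, ← integral_const_mul, ← integral_sub hFk hzk,
    ← integral_const_mul]
  refine norm_integral_le_of_norm_le (hki.const_mul ε) (.of_forall fun u => ?_)
  rw [← sub_mul, norm_mul, Complex.norm_real, Real.norm_of_nonneg (le_max_right _ _)]
  by_cases hu : ‖z - u‖ < δ
  · gcongr
    exact h u hu
  · rw [hzero u (not_lt.1 hu), mul_zero, mul_zero]

end BallMoment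

section CauchyTransform

open MeasureTheory

variable {K : Set ℂ} [CompactSpace K] {μ : ℂ → ℂ} {B r : ℝ}

theorem errorKernel_nonneg (r : ℝ) (w : ℂ) : 0 ≤ errorKernel r w := by
  unfold errorKernel
  positivity

theorem integrable_errorKernel_sub (hr : 0 < r) (z : ℂ) :
    Integrable fun ζ => errorKernel r (z - ζ) :=
  (integrable_errorKernel hr).1.comp_sub_left z

theorem integrableOn_bdd_mul (hμ : StronglyMeasurable μ) (hB : ∀ ζ, ‖μ ζ‖ ≤ B) {S : Set ℂ}
    {g : ℂ → ℂ} (hg : IntegrableOn g S) : IntegrableOn (fun ζ => μ ζ * g ζ) S :=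
  Integrable.bdd_mul hg hμ.aestronglyMeasurable (.of_forall hB)

/-- Approximation on `K` of the Cauchy transform of a bounded density on a small set near `Kᶜ`. -/
theorem exists_polyApprox_setIntegral_of_subset_closedBall (hc : IsPreconnected Kᶜ)
    (hμ : StronglyMeasurable μ) (hB : ∀ ζ, ‖μ ζ‖ ≤ B) (hr : 0 < r) {c : ℂ} (hcK : c ∉ K)
    {S : Set ℂ} (hS : MeasurableSet S) (hSc : S ⊆ Metric.closedBall c r) :
    ∃ G, PolyApprox K G ∧ ∀ z ∈ K, ‖(∫ ζ in S, μ ζ * (z - ζ)⁻¹) - G z‖ ≤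
      10 ^ 8 * B * ∫ ζ in S, errorKernel r (z - ζ) := by
  obtain ⟨g, a, hg, hga⟩ := exists_cauchy_kernel_approx hc hcK hr
  have hB0 : 0 ≤ B := (norm_nonneg _).trans (hB 0)
  refine ⟨fun z => (∫ ζ in S, μ ζ) * g z + (∫ ζ in S, μ ζ * (ζ - a)) * g z ^ 2,
    ((PolyApprox.const _).mul hg).add ((PolyApprox.const _).mul (hg.pow 2)), fun z hz => ?_⟩
  have hcpt := isCompact_closedBall c r
  have hcont {h : ℂ → ℂ} (hh : Continuous h) : IntegrableOn (fun ζ => μ ζ * h ζ) S :=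
    integrableOn_bdd_mul hμ hB ((hh.continuousOn.integrableOn_compact hcpt).mono_set hSc)
  have h1 : IntegrableOn (fun ζ => μ ζ) S := by
    simpa using hcont (h := fun _ => 1) continuous_const
  have h2 : IntegrableOn (fun ζ => μ ζ * (ζ - a)) S := hcont (by fun_prop)
  have h3 : IntegrableOn (fun ζ => μ ζ * (z - ζ)⁻¹) S :=
    integrableOn_bdd_mul hμ hB ((integrableOn_sub_inv z hcpt).mono_set hSc)
  have h4 : IntegrableOn (fun ζ => μ ζ * g z + μ ζ * (ζ - a) * g z ^ 2) S :=
    (h1.mul_const _).add (h2.mul_const _)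
  beta_reduce
  rw [← integral_mul_const, ← integral_mul_const, ← integral_add (h1.mul_const _)
    (h2.mul_const _), ← integral_sub h3 h4, ← integral_const_mul]
  refine norm_integral_le_of_norm_le
    ((integrable_errorKernel_sub hr z).integrableOn.const_mul _) ?_
  filter_upwards [ae_restrict_mem hS, ae_restrict_of_ae (Measure.ae_ne volume z)] with ζ hζ hne
  have h5 := hga z hz ζ (by simpa [dist_eq_norm] using hSc hζ) hne.symm
  calc ‖μ ζ * (z - ζ)⁻¹ - (μ ζ * g z + μ ζ * (ζ - a) * g z ^ 2)‖
      = ‖μ ζ‖ * ‖g z + (ζ - a) * g z ^ 2 - (z - ζ)⁻¹‖ := by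
        rw [← norm_mul, ← norm_neg]
        ring_nf
    _ ≤ B * (10 ^ 8 * errorKernel r (z - ζ)) := by
        gcongr
        exact hB ζ
    _ = _ := by ring

theorem exists_polyApprox_setIntegral (hc : IsPreconnected Kᶜ)
    (hμ : StronglyMeasurable μ) (hB : ∀ ζ, ‖μ ζ‖ ≤ B) (hr : 0 < r) (t : Finset ℂ) :
    (∀ c ∈ t, c ∉ K) → ∀ {S : Set ℂ}, MeasurableSet S → S ⊆ ⋃ c ∈ t, Metric.closedBall c r →
    ∃ G, PolyApprox K G ∧ ∀ z ∈ K, ‖(∫ ζ in S, μ ζ * (z - ζ)⁻¹) - G z‖ ≤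
      10 ^ 8 * B * ∫ ζ in S, errorKernel r (z - ζ) := by
  classical
  induction t using Finset.induction_on with
  | empty =>
    intro _ S _ hSt
    have hS : S = ∅ := by simpa using hSt
    exact ⟨fun _ => 0, PolyApprox.const 0, fun z _ => by simp [hS]⟩
  | insert c t _ ih =>
    intro ht S hS hSt
    have hball : MeasurableSet (Metric.closedBall c r) := measurableSet_closedBall
    obtain ⟨G₁, hG₁, h₁⟩ := exists_polyApprox_setIntegral_of_subset_closedBall hc hμ hB hr
      (ht c (Finset.mem_insert_self c t)) (hS.inter hball) inter_subset_right
    obtain ⟨G₂, hG₂, h₂⟩ := ih (fun c' hc' => ht c' (Finset.mem_insert_of_mem hc'))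
      (hS.diff hball) (by
        rintro ζ ⟨hζ, hζc⟩
        have := hSt hζ
        rw [Finset.set_biUnion_insert] at this
        exact this.resolve_left hζc)
    refine ⟨fun z => G₁ z + G₂ z, hG₁.add hG₂, fun z hz => ?_⟩
    have hcpt : IsCompact (⋃ c' ∈ (insert c t : Finset ℂ), Metric.closedBall c' r) :=
      (insert c t).isCompact_biUnion fun c' _ => isCompact_closedBall c' r
    have h3 : IntegrableOn (fun ζ => μ ζ * (z - ζ)⁻¹) S :=
      integrableOn_bdd_mul hμ hB ((integrableOn_sub_inv z hcpt).mono_set hSt)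
    rw [← integral_inter_add_sdiff hball h3, ← integral_inter_add_sdiff hball
      (integrable_errorKernel_sub hr z).integrableOn, mul_add, add_sub_add_comm]
    exact norm_add_le_of_le (h₁ z hz) (h₂ z hz)

/-- Approximation on `K` of the Cauchy transform of a bounded, boundedly supported density
living near `Kᶜ`. -/
theorem exists_polyApprox_integral (hc : IsPreconnected Kᶜ)
    (hμ : StronglyMeasurable μ) (hB : ∀ ζ, ‖μ ζ‖ ≤ B) (hr : 0 < r)
    (hbdd : Bornology.IsBounded (Function.support μ))
    (hnear : ∀ ζ, μ ζ ≠ 0 → ∃ c ∉ K, ‖ζ - c‖ < r) :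
    ∃ G, PolyApprox K G ∧ ∀ z ∈ K, ‖(∫ ζ, μ ζ * (z - ζ)⁻¹) - G z‖ ≤
      10 ^ 8 * B * (Real.pi ^ 2 * (2 * r)) := by
  have hr2 : 0 < 2 * r := by positivity
  have hcover : closure (Function.support μ) ⊆ ⋃ c ∈ Kᶜ, Metric.ball c (2 * r) := by
    intro ζ hζ
    obtain ⟨ζ', hζ', hd⟩ := Metric.mem_closure_iff.1 hζ r hr
    obtain ⟨c, hcK, hcd⟩ := hnear ζ' hζ'
    refine mem_biUnion hcK ?_
    rw [← dist_eq_norm] at hcd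
    rw [Metric.mem_ball]
    linarith [dist_triangle ζ ζ' c]
  obtain ⟨s, hsK, hsfin, hs⟩ := hbdd.isCompact_closure.elim_finite_subcover_image
    (fun c _ => Metric.isOpen_ball) hcover
  have hmeas : MeasurableSet (Function.support μ) := measurableSet_support hμ.measurable
  obtain ⟨G, hG, h⟩ := exists_polyApprox_setIntegral hc hμ hB hr2 hsfin.toFinset
    (fun c hc' => hsK (by simpa using hc')) hmeas (by
      refine (subset_closure.trans hs).trans ?_
      simp only [Finite.mem_toFinset]
      exact iUnion₂_mono fun c _ => Metric.ball_subset_closedBall)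
  refine ⟨G, hG, fun z hz => ?_⟩
  have h0 : ∫ ζ in Function.support μ, μ ζ * (z - ζ)⁻¹ = ∫ ζ, μ ζ * (z - ζ)⁻¹ :=
    setIntegral_eq_integral_of_forall_compl_eq_zero fun ζ hζ => by
      rw [Function.notMem_support.1 hζ, zero_mul]
  rw [← h0]
  have hB0 : 0 ≤ B := (norm_nonneg _).trans (hB 0)
  refine (h z hz).trans ?_
  gcongr
  rw [← (integrable_errorKernel hr2).2, ← integral_sub_left_eq_self _ volume z]
  exact setIntegral_le_integral (integrable_errorKernel_sub hr2 z)
    (.of_forall fun ζ => errorKernel_nonneg _ _)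

end CauchyTransform

section Forward

open MeasureTheory

variable {K : Set ℂ} {f : ℂ → ℂ}

theorem exists_continuous_extension_compactSupport (hK : IsCompact K) (hf : ContinuousOn f K) :
    ∃ F : ℂ → ℂ, Continuous F ∧ HasCompactSupport F ∧ EqOn F f K := by
  obtain ⟨F, hF⟩ := ContinuousMap.exists_restrict_eq hK.isClosed
    (⟨K.domRestrict f, hf.domRestrict⟩ : C(K, ℂ))
  obtain ⟨φ, hφK, -, hφc, -⟩ := exists_continuous_one_zero_of_isCompact hK isClosed_empty
    (disjoint_empty K)
  refine ⟨fun z => φ z • F z, by fun_prop, hφc.smul_right, fun z hz => ?_⟩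
  have hFz : F z = f z := DFunLike.congr_fun hF ⟨z, hz⟩
  simp [hφK hz, hFz]

theorem polyApprox_of_isPreconnected_compl [CompactSpace K] (hK : IsCompact K) (hc : IsPreconnected Kᶜ)
    (hf : ContinuousOn f K) (hd : DifferentiableOn ℂ f (interior K)) : PolyApprox K f := by
  obtain ⟨F, hF, hFc, hFf⟩ := exists_continuous_extension_compactSupport hK hf
  obtain ⟨R, hR⟩ : ∃ R, ∀ u, R < ‖u‖ → F u = 0 := by
    obtain ⟨R, hR⟩ := hFc.isCompact.isBounded.exists_norm_le
    refine ⟨R, fun u hu => image_eq_zero_of_notMem_tsupport fun hu' => ?_⟩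
    exact (hR u hu').not_gt hu
  refine PolyApprox.of_forall_exists fun ε hε => ?_
  set η : ℝ := ε / (1 + 4 * Real.pi * 10 ^ 8) with hη
  have hπ := Real.pi_pos
  have hη0 : 0 < η := by positivity
  obtain ⟨δ, hδ, hδF⟩ := Metric.uniformContinuous_iff.1
    (hFc.uniformContinuous_of_continuous hF) η hη0
  have hosc : ∀ z u, ‖z - u‖ < δ → ‖F u - F z‖ ≤ η := fun z u hzu => by
    rw [← dist_eq_norm, dist_comm]
    exact (hδF (by rwa [dist_eq_norm])).le
  have hnear : ∀ ζ, ballMoment F δ ζ ≠ 0 → ∃ c ∉ K, ‖ζ - c‖ < δ := by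
    intro ζ hζ
    by_contra! hcon
    have hsub : Metric.ball ζ δ ⊆ K := fun c hc' => by
      by_contra hcK
      rw [Metric.mem_ball, dist_comm, dist_eq_norm] at hc'
      exact (hcon c hcK).not_gt hc'
    refine hζ (ballMoment_eq_zero hF ?_)
    exact (hd.mono (interior_maximal hsub Metric.isOpen_ball)).congr fun x hx => hFf (hsub hx)
  have hbdd : Bornology.IsBounded (Function.support (ballMoment F δ)) := by
    refine (Metric.isBounded_closedBall (x := (0 : ℂ)) (r := R + δ)).subset fun ζ hζ => ?_
    by_contra hcon
    exact hζ (ballMoment_eq_zero_of_lt hR (by simpa using hcon))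
  obtain ⟨G, hG, hGz⟩ := exists_polyApprox_integral hc (stronglyMeasurable_ballMoment hF δ)
    (fun ζ => norm_ballMoment_le hF hδ (hosc ζ)) hδ hbdd hnear
  set C : ℝ := Real.pi * δ ^ 4 / 2 with hC
  have hC0 : 0 < C := by positivity
  refine ⟨fun z => ((-(Real.pi * C)⁻¹ : ℝ) : ℂ) * G z, (PolyApprox.const _).mul hG,
    fun z hz => ?_⟩
  have h1 := norm_integral_mul_max_sub_le hF hδ hR (hosc z)
  have h2 := hGz z hz
  rw [integral_ballMoment_mul_sub_inv hF hδ hR] at h2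
  rw [← hFf hz]
  generalize (∫ u, F u * (max (δ ^ 2 - ‖z - u‖ ^ 2) 0 : ℝ)) = J at h1 h2
  rw [← hC] at h1
  have hCc : (C : ℂ) ≠ 0 := by exact_mod_cast hC0.ne'
  have hπc : (Real.pi : ℂ) ≠ 0 := by exact_mod_cast hπ.ne'
  have h3 : F z - ((-(Real.pi * C)⁻¹ : ℝ) : ℂ) * G z =
      ((-C⁻¹ : ℝ) : ℂ) * (J - F z * C) +
        ((-(Real.pi * C)⁻¹ : ℝ) : ℂ) * (-Real.pi * J - G z) := by
    push_cast
    field_simp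
    ring
  rw [h3]
  calc _ ≤ C⁻¹ * (η * C) + (Real.pi * C)⁻¹ *
        (10 ^ 8 * (Real.pi * η * δ ^ 3) * (Real.pi ^ 2 * (2 * δ))) := by
        refine norm_add_le_of_le ?_ ?_
        · rw [norm_mul, Complex.norm_real, norm_neg, Real.norm_of_nonneg (by positivity)]
          gcongr
        · rw [norm_mul, Complex.norm_real, norm_neg, Real.norm_of_nonneg (by positivity)]
          gcongr
    _ = η * (1 + 4 * Real.pi * 10 ^ 8) := by
        rw [hC]
        field_simp
        ring
    _ = ε := div_mul_cancel₀ _ (by positivity)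

end Forward

section Converse

theorem Complex.isPreconnected_setOf_lt_norm (R : ℝ) :
    IsPreconnected {z : ℂ | R < ‖z‖} := by
  have h : {z : ℂ | R < ‖z‖} = (fun p : ℝ × ℝ => circleMap 0 p.1 p.2) '' Ioi R ×ˢ univ := by
    ext z
    constructor
    · intro hz
      exact ⟨(‖z‖, arg z), ⟨hz, mem_univ _⟩, by simp [circleMap]⟩
    · rintro ⟨p, ⟨hp, -⟩, rfl⟩
      simpa using lt_of_lt_of_le hp (le_abs_self p.1)
  rw [h]
  refine (isPreconnected_Ioi.prod isPreconnected_univ).image _ (Continuous.continuousOn ?_)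
  simp only [circleMap]
  fun_prop

variable {K : Set ℂ}

theorem not_isBounded_connectedComponentIn_compl (hK : IsCompact K)
    (h : ∀ f : ℂ → ℂ, ContinuousOn f K → DifferentiableOn ℂ f (interior K) →
      ∀ ε > 0, ∃ p : Polynomial ℂ, ∀ z ∈ K, ‖f z - p.eval z‖ < ε) {a : ℂ} (ha : a ∉ K) :
    ¬ Bornology.IsBounded (connectedComponentIn Kᶜ a) := by
  intro hbdd
  set V := connectedComponentIn Kᶜ a with hV
  have haV : a ∈ V := mem_connectedComponentIn ha
  have hVo : IsOpen V := hK.isClosed.isOpen_compl.connectedComponentIn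
  have hfr : frontier V ⊆ K := by
    intro z hz
    by_contra hzK
    have hz' : z ∉ V := by
      rw [hVo.frontier_eq] at hz
      exact hz.2
    have hnhds : connectedComponentIn Kᶜ z ∈ nhds z :=
      (hK.isClosed.isOpen_compl.connectedComponentIn).mem_nhds (mem_connectedComponentIn hzK)
    obtain ⟨w, hw1, hw2⟩ := mem_closure_iff_nhds.1 (frontier_subset_closure hz) _ hnhds
    refine hz' ?_
    rw [hV, connectedComponentIn_eq hw2, ← connectedComponentIn_eq hw1]
    exact mem_connectedComponentIn hzK
  obtain ⟨M, hM0, hM⟩ : ∃ M > 0, ∀ z ∈ K, ‖z - a‖ ≤ M := by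
    obtain ⟨M, hM⟩ := (hK.image (f := fun z => z - a) (by fun_prop)).isBounded.exists_norm_le
    refine ⟨max M 1, by positivity, fun z hz => (hM _ (mem_image_of_mem _ hz)).trans
      (le_max_left _ _)⟩
  have hne : ∀ z ∈ K, z - a ≠ 0 := fun z hz h0 => ha (sub_eq_zero.1 h0 ▸ hz)
  obtain ⟨p, hp⟩ := h (fun z => (z - a)⁻¹)
    (ContinuousOn.inv₀ (by fun_prop) hne)
    (DifferentiableOn.inv (by fun_prop) fun z hz => hne z (interior_subset hz))
    (1 / (2 * M)) (by positivity)
  have hle := Complex.norm_le_of_forall_mem_frontier_norm_le (C := 1 / 2) hbdd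
    (f := fun z => 1 - (z - a) * p.eval z)
    (Differentiable.diffContOnCl (by fun_prop)) (fun z hz => ?_) (subset_closure haV)
  · norm_num at hle
  · have hz := hfr hz
    have h1 : 1 - (z - a) * p.eval z = (z - a) * ((z - a)⁻¹ - p.eval z) := by
      rw [mul_sub, mul_inv_cancel₀ (hne z hz)]
    rw [h1, norm_mul]
    calc ‖z - a‖ * ‖(z - a)⁻¹ - p.eval z‖ ≤ M * (1 / (2 * M)) := by
          gcongr
          · exact hM z hz
          · exact (hp z hz).le
      _ = 1 / 2 := by field_simp

theorem isConnected_compl_of_forall_exists_polynomial (hK : IsCompact K)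
    (h : ∀ f : ℂ → ℂ, ContinuousOn f K → DifferentiableOn ℂ f (interior K) →
      ∀ ε > 0, ∃ p : Polynomial ℂ, ∀ z ∈ K, ‖f z - p.eval z‖ < ε) : IsConnected Kᶜ := by
  obtain ⟨R, hR0, hR⟩ := hK.isBounded.exists_pos_norm_le
  have hW : {z : ℂ | R < ‖z‖} ⊆ Kᶜ := fun z hz hzK => (hR z hzK).not_gt hz
  have hw0 : ((R + 1 : ℝ) : ℂ) ∈ {z : ℂ | R < ‖z‖} := by
    rw [mem_ofPred_eq, Complex.norm_real, Real.norm_of_nonneg (by positivity)]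
    linarith
  refine ⟨⟨_, hW hw0⟩, isPreconnected_of_forall ((R + 1 : ℝ) : ℂ) fun a ha =>
    ⟨connectedComponentIn Kᶜ a, connectedComponentIn_subset _ _, ?_, mem_connectedComponentIn ha,
      isPreconnected_connectedComponentIn⟩⟩
  obtain ⟨w, hwV, hw⟩ : ∃ w ∈ connectedComponentIn Kᶜ a, R < ‖w‖ := by
    by_contra! hcon
    exact not_isBounded_connectedComponentIn_compl hK h ha
      (isBounded_iff_forall_norm_le.2 ⟨R, hcon⟩)
  rw [connectedComponentIn_eq hwV]
  exact (isPreconnected_setOf_lt_norm R).subset_connectedComponentIn hw hW hw0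

end Converse

/-- Mergelyan's theorem: for a compact set `K ⊆ ℂ`, the complement of `K` is connected
if and only if every function continuous on `K` and holomorphic on the interior of `K`
can be uniformly approximated on `K` by algebraic polynomials. -/
theorem mergelyan (K : Set ℂ) (hK : IsCompact K) :
    IsConnected Kᶜ ↔
      ∀ f : ℂ → ℂ, ContinuousOn f K → DifferentiableOn ℂ f (interior K) →
        ∀ ε > 0, ∃ p : Polynomial ℂ, ∀ z ∈ K, ‖f z - p.eval z‖ < ε := by
  refine ⟨fun hc f hf hd ε hε => ?_, isConnected_compl_of_forall_exists_polynomial hK⟩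
  have := isCompact_iff_compactSpace.1 hK
  exact (polyApprox_of_isPreconnected_compl hK hc.isPreconnected hf hd).exists_polynomial hε
end
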